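/- arXiv:2306.04113 — 7 statements merged into one kernel-verified Lean document; each statement's English description precedes it below -/
import Mathlib

section
/- Let L be a join-semidistributive lattice with more than one element that has a greatest element 1, and let I be an ideal of L that is maximal with respect to not containing 1. Then the partition of L into the two blocks I and L ∖ I is the partition into congruence classes of a congruence of L. Consequently, a simple join-semidistributive lattice with more than two elements has no greatest element. -/
/-! ### Basic definitions: semidistributivity, lattice congruences -/

/-- Join-semidistributivity: `u = x ⊔ y = x ⊔ z` implies `u = x ⊔ (y ⊓ z)`. -/
def JoinSD (L : Type*) [Lattice L] : Prop :=
  ∀ u x y z : L, u = x ⊔ y → u = x ⊔ z → u = x ⊔ (y ⊓ z)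

/-- Meet-semidistributivity: `w = x ⊓ y = x ⊓ z` implies `w = x ⊓ (y ⊔ z)`. -/
def MeetSD (L : Type*) [Lattice L] : Prop :=
  ∀ w x y z : L, w = x ⊓ y → w = x ⊓ z → w = x ⊓ (y ⊔ z)

/-- Semidistributivity. -/
def SD (L : Type*) [Lattice L] : Prop := JoinSD L ∧ MeetSD L

/-- A congruence of a lattice: an equivalence relation compatible with `⊔` and `⊓`. -/
@[ext]
structure LatCon (L : Type*) [Lattice L] where
  r : L → L → Prop
  refl' : ∀ x, r x x
  symm' : ∀ {x y}, r x y → r y x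
  trans' : ∀ {x y z}, r x y → r y z → r x z
  sup' : ∀ {x y x' y'}, r x y → r x' y' → r (x ⊔ x') (y ⊔ y')
  inf' : ∀ {x y x' y'}, r x y → r x' y' → r (x ⊓ x') (y ⊓ y')

namespace LatCon

variable {L : Type*} [Lattice L]

/-- Congruences are ordered by inclusion; this is the order of the congruence
lattice `Con L`. -/
instance instPO : PartialOrder (LatCon L) where
  le c d := ∀ x y, c.r x y → d.r x y
  le_refl _ _ _ h := h
  le_trans _ _ _ h1 h2 x y h := h2 x y (h1 x y h)
  le_antisymm c d h1 h2 := by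
    ext x y
    exact ⟨h1 x y, h2 x y⟩

/-- The congruence lattice `Con L`. -/
instance instLattice : Lattice (LatCon L) where
  sup c d :=
    { r := fun x y => ∀ e : LatCon L, c ≤ e → d ≤ e → e.r x y
      refl' := fun x e _ _ => e.refl' x
      symm' := fun h e hc hd => e.symm' (h e hc hd)
      trans' := fun h1 h2 e hc hd => e.trans' (h1 e hc hd) (h2 e hc hd)
      sup' := fun h1 h2 e hc hd => e.sup' (h1 e hc hd) (h2 e hc hd)
      inf' := fun h1 h2 e hc hd => e.inf' (h1 e hc hd) (h2 e hc hd) }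
  le_sup_left c d := fun x y h e hc _ => hc x y h
  le_sup_right c d := fun x y h e _ hd => hd x y h
  sup_le c d e hc hd := fun x y h => h e hc hd
  inf c d :=
    { r := fun x y => c.r x y ∧ d.r x y
      refl' := fun x => ⟨c.refl' x, d.refl' x⟩
      symm' := fun h => ⟨c.symm' h.1, d.symm' h.2⟩
      trans' := fun h1 h2 => ⟨c.trans' h1.1 h2.1, d.trans' h1.2 h2.2⟩
      sup' := fun h1 h2 => ⟨c.sup' h1.1 h2.1, d.sup' h1.2 h2.2⟩
      inf' := fun h1 h2 => ⟨c.inf' h1.1 h2.1, d.inf' h1.2 h2.2⟩ }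
  inf_le_left c d := fun x y h => h.1
  inf_le_right c d := fun x y h => h.2
  le_inf c d e hc hd := fun x y h => ⟨hc x y h, hd x y h⟩

/-- The equality congruence is the least congruence. -/
instance instOrderBot : OrderBot (LatCon L) where
  bot :=
    { r := Eq
      refl' := fun _ => rfl
      symm' := Eq.symm
      trans' := Eq.trans
      sup' := by rintro x y x' y' rfl rfl; rfl
      inf' := by rintro x y x' y' rfl rfl; rfl }
  bot_le c := by rintro x y rfl; exact c.refl' x

/-- The all congruence is the greatest congruence. -/
instance instOrderTop : OrderTop (LatCon L) where
  top :=
    { r := fun _ _ => True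
      refl' := fun _ => trivial
      symm' := fun _ => trivial
      trans' := fun _ _ => trivial
      sup' := fun _ _ => trivial
      inf' := fun _ _ => trivial }
  le_top _ _ _ _ := trivial

/-- The congruence generated by a pair `(a, b)`. -/
def gen (a b : L) : LatCon L where
  r x y := ∀ c : LatCon L, c.r a b → c.r x y
  refl' x := fun c _ => c.refl' x
  symm' h := fun c hc => c.symm' (h c hc)
  trans' h1 h2 := fun c hc => c.trans' (h1 c hc) (h2 c hc)
  sup' h1 h2 := fun c hc => c.sup' (h1 c hc) (h2 c hc)
  inf' h1 h2 := fun c hc => c.inf' (h1 c hc) (h2 c hc)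

/-- The congruence generated by a set of pairs. -/
def genSet (P : Set (L × L)) : LatCon L where
  r x y := ∀ c : LatCon L, (∀ p ∈ P, c.r p.1 p.2) → c.r x y
  refl' x := fun c _ => c.refl' x
  symm' h := fun c hc => c.symm' (h c hc)
  trans' h1 h2 := fun c hc => c.trans' (h1 c hc) (h2 c hc)
  sup' h1 h2 := fun c hc => c.sup' (h1 c hc) (h2 c hc)
  inf' h1 h2 := fun c hc => c.inf' (h1 c hc) (h2 c hc)

end LatCon

/-- A lattice is simple if its congruence lattice has exactly two elements, namely
the equality relation (`⊥`) and the all relation (`⊤`). -/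
def IsSimpleLat (L : Type*) [Lattice L] : Prop :=
  (∃ x y : L, x ≠ y) ∧ ∀ c : LatCon L, c = (⊥ : LatCon L) ∨ c = (⊤ : LatCon L)

/-- An FN lattice: a simple, infinite, semidistributive lattice. -/
def IsFN (F : Type*) [Lattice F] : Prop := Infinite F ∧ IsSimpleLat F ∧ SD F

/-! ### Helpers for quantifying over lattice structures -/

/-- `SD` for an explicitly given lattice structure. -/
def SDP (K : Type*) (instK : Lattice K) : Prop := by
  letI := instK; exact SD K

/-- `IsFN` for an explicitly given lattice structure. -/
def IsFNP (F : Type*) (instF : Lattice F) : Prop := by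
  letI := instF; exact IsFN F

/-- The congruence lattice of `K` (with explicitly given lattice structure) is
order-isomorphic to `D`. -/
def ConIso (K : Type*) (instK : Lattice K) (D : Type*) [LE D] : Prop := by
  letI := instK; exact Nonempty (LatCon K ≃o D)

/-- `K` (with explicitly given lattice structure) has no greatest and no least element. -/
def UnboundedP (K : Type*) (instK : Lattice K) : Prop := by
  letI := instK; exact (∀ x : K, ¬ IsTop x) ∧ (∀ x : K, ¬ IsBot x)

/-- The order `≤` of an explicitly given lattice structure. -/
def lleOf {α : Type*} (inst : Lattice α) (x y : α) : Prop := by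
  letI := inst; exact x ≤ y

/-- The join of an explicitly given lattice structure. -/
def lsupOf {α : Type*} (inst : Lattice α) (x y : α) : α := by
  letI := inst; exact x ⊔ y

/-- The meet of an explicitly given lattice structure. -/
def linfOf {α : Type*} (inst : Lattice α) (x y : α) : α := by
  letI := inst; exact x ⊓ y

/-! ### The doubling construction -/

/-- The underlying set of the doubling `L[u]`: `(L ∖ {u}) ∪ {u₀, u₁}`, where
`u₀ = Sum.inr false` and `u₁ = Sum.inr true`. -/
def Doubled (L : Type*) (u : L) : Type _ := {x : L // x ≠ u} ⊕ Bool

/-- The element `u₀` of `L[u]`. -/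
def dbl0 {L : Type*} (u : L) : Doubled L u := Sum.inr false

/-- The element `u₁` of `L[u]`. -/
def dbl1 {L : Type*} (u : L) : Doubled L u := Sum.inr true

/-- The order `≤ᵤ` of the doubling `L[u]`. -/
def dle {L : Type*} [Lattice L] (u : L) : Doubled L u → Doubled L u → Prop
  | Sum.inl x, Sum.inl y => (x : L) ≤ y
  | Sum.inl x, Sum.inr _ => (x : L) ≤ u
  | Sum.inr _, Sum.inl y => u ≤ (y : L)
  | Sum.inr i, Sum.inr j => i ≤ j

section
open Classical

/-- The map `L → L[u]` sending `u` to `u₀` and fixing everything else. -/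
noncomputable def iota0 {L : Type*} (u : L) : L → Doubled L u := fun x =>
  if h : x = u then Sum.inr false else Sum.inl ⟨x, h⟩

/-- The map `L → L[u]` sending `u` to `u₁` and fixing everything else. -/
noncomputable def iota1 {L : Type*} (u : L) : L → Doubled L u := fun x =>
  if h : x = u then Sum.inr true else Sum.inl ⟨x, h⟩

end

/-- The projection `L[u] → L` collapsing `u₀` and `u₁` to `u`. -/
def dproj {L : Type*} (u : L) : Doubled L u → L
  | Sum.inl x => (x : L)
  | Sum.inr _ => u

/-! ### Doubling a finite antichain -/

/-- The underlying set of `L[U]`: `(L ∖ U) ∪ ⋃_{u ∈ U} {u₀, u₁}`, where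
`u₀ = Sum.inr (u, false)` and `u₁ = Sum.inr (u, true)`. -/
def DoubledS (L : Type*) (U : Set L) : Type _ := {x : L // x ∉ U} ⊕ (U × Bool)

section
open Classical

/-- The order of `L[U]`. -/
noncomputable def dleS {L : Type*} [Lattice L] (U : Set L) : DoubledS L U → DoubledS L U → Prop
  | Sum.inl x, Sum.inl y => (x : L) ≤ y
  | Sum.inl x, Sum.inr ui => (x : L) ≤ (ui.1 : L)
  | Sum.inr ui, Sum.inl y => (ui.1 : L) ≤ (y : L)
  | Sum.inr ui, Sum.inr vj =>
      if (ui.1 : L) = (vj.1 : L) then ui.2 ≤ vj.2 else (ui.1 : L) ≤ (vj.1 : L)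

end

/-! ### Isolated intervals and the gluing construction -/

/-- An interval `[a, b]` is isolated if `b` covers `a` and both `a` and `b` are
doubly irreducible. -/
def Isolated {L : Type*} [Lattice L] (a b : L) : Prop :=
  a ⋖ b ∧ SupIrred a ∧ InfIrred a ∧ SupIrred b ∧ InfIrred b

/-- The underlying set of `K = L^{a,b} ⊔ F`. -/
def Glued (L F : Type*) (a b : L) : Type _ := {x : L // x ≠ a ∧ x ≠ b} ⊕ F

/-- The order on `K = L^{a,b} ⊔ F`: on each summand the original order; and
`x < f` for `x ∈ L^{a,b}`, `f ∈ F` iff `x ≤ a`, `f < x` iff `b ≤ x`. -/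
def gle {L F : Type*} [Lattice L] [Lattice F] (a b : L) :
    Glued L F a b → Glued L F a b → Prop
  | Sum.inl x, Sum.inl y => (x : L) ≤ y
  | Sum.inl x, Sum.inr _ => (x : L) ≤ a
  | Sum.inr _, Sum.inl y => b ≤ (y : L)
  | Sum.inr f, Sum.inr g => f ≤ g


/-! ### STATEMENT 0 -/

/-- If the complement of an ideal is closed under meets, then the ideal and its complement are the
classes of a congruence. -/
def LatCon.ofIdeal {L : Type*} [Lattice L] (I : Order.Ideal L)
    (hI : ∀ x y : L, x ∉ I → y ∉ I → x ⊓ y ∉ I) : LatCon L where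
  r x y := x ∈ I ↔ y ∈ I
  refl' _ := Iff.rfl
  symm' := Iff.symm
  trans' := Iff.trans
  sup' h h' := by rw [Order.Ideal.sup_mem_iff, Order.Ideal.sup_mem_iff, h, h']
  inf' h h' := by
    have key : ∀ a b : L, a ⊓ b ∈ I ↔ a ∈ I ∨ b ∈ I := fun a b =>
      ⟨fun hab => by by_contra! hn; exact hI a b hn.1 hn.2 hab,
        fun hab => hab.elim (I.lower inf_le_left) (I.lower inf_le_right)⟩
    rw [key, key, h, h']

/-- In a join-semidistributive lattice with a greatest element, the complement of an ideal that is
maximal with respect to not containing `⊤` is closed under meets. -/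
theorem JoinSD.inf_notMem_of_maximal {L : Type*} [Lattice L] [OrderTop L] (hL : JoinSD L)
    {I : Order.Ideal L} (hI : (⊤ : L) ∉ I)
    (hmax : ∀ J : Order.Ideal L, I ≤ J → (⊤ : L) ∉ J → J = I) {x y : L}
    (hx : x ∉ I) (hy : y ∉ I) : x ⊓ y ∉ I := by
  have key : ∀ z ∉ I, ∃ i ∈ I, i ⊔ z = ⊤ := by
    intro z hz
    have hlt : I < I ⊔ Order.Ideal.principal z := Order.Ideal.lt_sup_principal_of_notMem hz
    have htop : (⊤ : L) ∈ I ⊔ Order.Ideal.principal z := by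
      by_contra h
      exact hlt.ne' (hmax _ hlt.le h)
    obtain ⟨i, hi, j, hj, hij⟩ := Order.Ideal.mem_sup.1 htop
    exact ⟨i, hi, top_le_iff.1 (hij.trans (sup_le_sup_left (Order.Ideal.mem_principal.1 hj) i))⟩
  obtain ⟨i, hi, hix⟩ := key x hx
  obtain ⟨j, hj, hjy⟩ := key y hy
  have h := hL ⊤ (i ⊔ j) x y
    (top_le_iff.1 (hix.symm.le.trans (sup_le_sup_right le_sup_left x))).symm
    (top_le_iff.1 (hjy.symm.le.trans (sup_le_sup_right le_sup_right y))).symm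
  intro hxy
  exact hI (h ▸ Order.Ideal.sup_mem (Order.Ideal.sup_mem hi hj) hxy)

/-- An ideal of a join-semidistributive lattice that is maximal with respect to not containing `⊤`
is, together with its complement, the partition into the classes of a congruence. -/
theorem JoinSD.exists_latCon_of_maximal {L : Type*} [Lattice L] [OrderTop L] (hL : JoinSD L)
    {I : Order.Ideal L} (hI : (⊤ : L) ∉ I)
    (hmax : ∀ J : Order.Ideal L, I ≤ J → (⊤ : L) ∉ J → J = I) :
    ∃ c : LatCon L, ∀ x y : L, c.r x y ↔ ((x ∈ I ∧ y ∈ I) ∨ (x ∉ I ∧ y ∉ I)) :=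
  ⟨LatCon.ofIdeal I fun _ _ hx hy => hL.inf_notMem_of_maximal hI hmax hx hy,
    fun _ _ => iff_iff_and_or_not_and_not⟩

/-- A nontrivial lattice with a greatest element has an ideal that is maximal with respect to not
containing `⊤`. -/
theorem Order.Ideal.exists_maximal_top_notMem (L : Type*) [Lattice L] [OrderTop L]
    [Nontrivial L] :
    ∃ I : Order.Ideal L, (⊤ : L) ∉ I ∧ ∀ J : Order.Ideal L, I ≤ J → (⊤ : L) ∉ J → J = I := by
  obtain ⟨a, ha⟩ := exists_ne (⊤ : L)
  have hp : Order.Ideal.principal a ≠ ⊤ := by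
    rw [← Order.Ideal.top_notMem_iff_ne_top, Order.Ideal.mem_principal, top_le_iff]
    exact ha
  obtain ⟨I, hI, -⟩ := (eq_top_or_exists_le_coatom (Order.Ideal.principal a)).resolve_left hp
  exact ⟨I, Order.Ideal.top_notMem_iff_ne_top.2 hI.1, fun J hIJ hJ =>
    (hI.le_iff.1 hIJ).resolve_left (Order.Ideal.top_notMem_iff_ne_top.1 hJ)⟩

/-- Let `L` be a join-semidistributive lattice with more than one element having a
greatest element `⊤`, and let `I` be an ideal of `L` maximal with respect to not
containing `⊤`.  Then the partition of `L` into the blocks `I` and `L ∖ I` is the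
partition into congruence classes of a congruence of `L`.  Consequently, a simple
join-semidistributive lattice with more than two elements has no greatest element. -/
theorem statement0 :
    (∀ (L : Type) [instL : Lattice L] [instT : OrderTop L], Nontrivial L → JoinSD L →
      ∀ I : Order.Ideal L, (⊤ : L) ∉ I →
        (∀ J : Order.Ideal L, I ≤ J → (⊤ : L) ∉ J → J = I) →
        ∃ c : LatCon L, ∀ x y : L, c.r x y ↔ ((x ∈ I ∧ y ∈ I) ∨ (x ∉ I ∧ y ∉ I))) ∧
    (∀ (L : Type) [instL : Lattice L], JoinSD L → IsSimpleLat L →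
      (∃ x y z : L, x ≠ y ∧ x ≠ z ∧ y ≠ z) → ∀ t : L, ¬ IsTop t) := by
  refine ⟨fun L _ _ _ hL I hI hmax => hL.exists_latCon_of_maximal hI hmax, ?_⟩
  rintro L _ hL ⟨⟨a, b, hab⟩, hsimple⟩ ⟨x, y, z, hxy, hxz, hyz⟩ t ht
  let _ : OrderTop L := { top := t, le_top := ht }
  have : Nontrivial L := ⟨a, b, hab⟩
  obtain ⟨I, hI, hmax⟩ := Order.Ideal.exists_maximal_top_notMem L
  obtain ⟨c, hc⟩ := hL.exists_latCon_of_maximal hI hmax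
  rcases hsimple c with rfl | rfl
  · have heq : ∀ u v : L, (u ∈ I ↔ v ∈ I) → u = v := fun u v h =>
      (hc u v).2 (iff_iff_and_or_not_and_not.1 h)
    have h₁ := mt (heq x y) hxy
    have h₂ := mt (heq x z) hxz
    have h₃ := mt (heq y z) hyz
    tauto
  · obtain ⟨i, hi⟩ := I.nonempty
    rcases (hc i ⊤).1 trivial with h | h
    · exact hI h.2
    · exact h.1 hi
end

section
/- A simple semidistributive lattice with more than two elements has neither a least nor a greatest element; in particular, an FN lattice (a simple, infinite, semidistributive lattice) is unbounded. -/
/-- In a meet-semidistributive lattice with least element `b`, identify `x` and `y` when they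
are disjoint from the same elements below `a`. -/
def LatCon.disjointBelow {L : Type*} [Lattice L] (hL : MeetSD L) {b : L} (hb : IsBot b) (a : L) :
    LatCon L where
  r x y := ∀ f ≤ a, f ⊓ x = b ↔ f ⊓ y = b
  refl' _ _ _ := Iff.rfl
  symm' h f hf := (h f hf).symm
  trans' h₁ h₂ f hf := (h₁ f hf).trans (h₂ f hf)
  sup' {x y x' y'} h h' f hf := by
    have key (u v : L) : f ⊓ (u ⊔ v) = b ↔ f ⊓ u = b ∧ f ⊓ v = b := by
      refine ⟨fun e => ⟨?_, ?_⟩, fun e => (hL b f u v e.1.symm e.2.symm).symm⟩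
      · exact le_antisymm ((inf_le_inf_left f le_sup_left).trans_eq e) (hb _)
      · exact le_antisymm ((inf_le_inf_left f le_sup_right).trans_eq e) (hb _)
    rw [key, key, h f hf, h' f hf]
  inf' {x y x' y'} h h' f hf := by
    rw [inf_comm x x', ← inf_assoc, h _ (inf_le_left.trans hf), inf_right_comm,
      h' _ (inf_le_left.trans hf), inf_assoc]

/-- In a simple meet-semidistributive lattice with a least element, every other element is
the greatest element. -/
theorem IsSimpleLat.isTop_of_ne_bot {L : Type*} [Lattice L] (hs : IsSimpleLat L) (hL : MeetSD L)
    {b a : L} (hb : IsBot b) (hab : a ≠ b) : IsTop a := by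
  intro x
  rcases hs.2 (LatCon.disjointBelow hL hb a) with h | h
  · have hx : (LatCon.disjointBelow hL hb a).r x (x ⊓ a) := fun f hf => by
      rw [inf_comm x a, ← inf_assoc, inf_eq_left.2 hf]
    rw [h] at hx
    have hx : x = x ⊓ a := hx
    exact inf_eq_left.1 hx.symm
  · have ha : (LatCon.disjointBelow hL hb a).r a b := by rw [h]; trivial
    have := (ha a le_rfl).2 (inf_eq_right.2 (hb a))
    rw [inf_idem] at this
    exact absurd this hab

theorem IsSimpleLat.not_isBot {L : Type*} [Lattice L] (hs : IsSimpleLat L) (hL : MeetSD L)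
    (h3 : ∃ x y z : L, x ≠ y ∧ x ≠ z ∧ y ≠ z) (b : L) : ¬ IsBot b := by
  intro hb
  have key (u v : L) (hu : u ≠ b) (hv : v ≠ b) : u = v :=
    le_antisymm (hs.isTop_of_ne_bot hL hb hv u) (hs.isTop_of_ne_bot hL hb hu v)
  obtain ⟨x, y, z, hxy, hxz, hyz⟩ := h3
  by_cases hx : x = b
  · exact hyz (key y z (hx ▸ hxy.symm) (hx ▸ hxz.symm))
  · by_cases hy : y = b
    · exact hxz (key x z hx (hy ▸ hyz.symm))
    · exact hxy (key x y hx hy)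

theorem IsSimpleLat.dual {L : Type*} [Lattice L] (hs : IsSimpleLat L) : IsSimpleLat Lᵒᵈ := by
  refine ⟨hs.1, fun c => ?_⟩
  let d : LatCon L :=
    { r := fun x y => c.r (OrderDual.toDual x) (OrderDual.toDual y)
      refl' := fun x => c.refl' x
      symm' := fun h => c.symm' h
      trans' := fun h₁ h₂ => c.trans' h₁ h₂
      sup' := fun h₁ h₂ => c.inf' h₁ h₂
      inf' := fun h₁ h₂ => c.sup' h₁ h₂ }
  have hr : c.r = d.r := rfl
  rcases hs.2 d with h | h
  · left
    apply LatCon.ext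
    rw [hr, h]
    rfl
  · right
    apply LatCon.ext
    rw [hr, h]
    rfl

theorem IsSimpleLat.not_isTop {L : Type*} [Lattice L] (hs : IsSimpleLat L) (hL : JoinSD L)
    (h3 : ∃ x y z : L, x ≠ y ∧ x ≠ z ∧ y ≠ z) (t : L) : ¬ IsTop t :=
  fun ht => IsSimpleLat.not_isBot (L := Lᵒᵈ) hs.dual hL h3 (OrderDual.toDual t) ht.toDual

/-! ### STATEMENT 1 -/

/-- A simple semidistributive lattice with more than two elements has neither a
least nor a greatest element; in particular, an FN lattice (a simple, infinite,
semidistributive lattice) is unbounded. -/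
theorem statement1 :
    (∀ (L : Type) [instL : Lattice L], SD L → IsSimpleLat L →
      (∃ x y z : L, x ≠ y ∧ x ≠ z ∧ y ≠ z) →
      (∀ t : L, ¬ IsTop t) ∧ (∀ t : L, ¬ IsBot t)) ∧
    (∀ (F : Type) [instF : Lattice F], IsFN F →
      (∀ t : F, ¬ IsTop t) ∧ (∀ t : F, ¬ IsBot t)) := by
  have main (L : Type) [Lattice L] (hL : SD L) (hs : IsSimpleLat L)
      (h3 : ∃ x y z : L, x ≠ y ∧ x ≠ z ∧ y ≠ z) :
      (∀ t : L, ¬ IsTop t) ∧ (∀ t : L, ¬ IsBot t) :=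
    ⟨hs.not_isTop hL.1 h3, hs.not_isBot hL.2 h3⟩
  refine ⟨main, fun F _ hF => main F hF.2.2 hF.2.1 ?_⟩
  have := hF.1
  obtain ⟨x⟩ : Nonempty F := inferInstance
  obtain ⟨y, hy⟩ := Infinite.exists_notMem_finset ({x} : Finset F)
  classical
  obtain ⟨z, hz⟩ := Infinite.exists_notMem_finset ({x, y} : Finset F)
  simp only [Finset.mem_insert, Finset.mem_singleton, not_or] at hy hz
  exact ⟨x, y, z, Ne.symm hy, Ne.symm hz.1, Ne.symm hz.2⟩
end

section
/- Let L be a lattice and u ∈ L, and let L[u] be the doubling of u in L. Then: (i) L[u] is a lattice under the order ≤_u; (ii) u₀ is meet-irreducible and u₁ is join-irreducible in L[u], and u₀ ≺ u₁ (u₁ covers u₀); (iii) for a, b, c ∈ L with u ∉ {a, b, c}, a ∨ b = c holds in L if and only if it holds in L[u], and dually for meets; (iv) for a ∈ L with a ≠ u, the meet u₀ ∧ a in L[u] equals the meet u ∧ a computed in L, and dually the join u₁ ∨ a in L[u] equals u ∨ a computed in L; (v) the congruence θ of L[u] generated by the pair (u₀, u₁) has exactly one nontrivial congruence class, namely {u₀,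 u₁}, and the quotient lattice L[u]/θ is isomorphic to L. -/
/-! ### STATEMENT 3 -/

namespace Doubled

variable {L : Type*} {u : L}

theorem iota0_self : iota0 u u = dbl0 u := dif_pos rfl

theorem iota0_of_ne {s : L} (hs : s ≠ u) : iota0 u s = Sum.inl ⟨s, hs⟩ := dif_neg hs

@[simp]
theorem dproj_iota0 (s : L) : dproj u (iota0 u s) = s := by
  rcases eq_or_ne s u with rfl | hs
  · rw [iota0_self]
    rfl
  · rw [iota0_of_ne hs]
    rfl

theorem iota1_self : iota1 u u = dbl1 u := dif_pos rfl

theorem iota1_of_ne {s : L} (hs : s ≠ u) : iota1 u s = Sum.inl ⟨s, hs⟩ := dif_neg hs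

@[simp]
theorem dproj_iota1 (s : L) : dproj u (iota1 u s) = s := by
  rcases eq_or_ne s u with rfl | hs
  · rw [iota1_self]
    rfl
  · rw [iota1_of_ne hs]
    rfl

theorem eq_inl_of_dproj_eq {x : Doubled L u} {c : {x : L // x ≠ u}} (h : dproj u x = c) :
    x = Sum.inl c := by
  rcases x with x | i
  · exact congrArg Sum.inl (Subtype.ext h)
  · exact absurd h.symm c.2

theorem eq_iota0_of_dproj_eq {x : Doubled L u} {s : L} (hs : s ≠ u) (h : dproj u x = s) :
    x = iota0 u s := by
  rw [iota0_of_ne hs]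
  exact eq_inl_of_dproj_eq (c := ⟨s, hs⟩) h

theorem eq_iota1_of_dproj_eq {x : Doubled L u} {s : L} (hs : s ≠ u) (h : dproj u x = s) :
    x = iota1 u s := by
  rw [iota1_of_ne hs]
  exact eq_inl_of_dproj_eq (c := ⟨s, hs⟩) h

theorem dproj_eq_dproj_iff {x y : Doubled L u} :
    dproj u x = dproj u y ↔
      x = y ∨ (x ∈ ({dbl0 u, dbl1 u} : Set (Doubled L u)) ∧
        y ∈ ({dbl0 u, dbl1 u} : Set (Doubled L u))) := by
  have mem_pair : ∀ i : Bool, (Sum.inr i : Doubled L u) ∈ ({dbl0 u, dbl1 u} : Set _) := by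
    rintro (_ | _)
    · exact Or.inl rfl
    · exact Or.inr rfl
  constructor
  · rcases y with y | j
    · exact fun h => Or.inl (eq_inl_of_dproj_eq h)
    rcases x with x | i
    · exact fun h => absurd h x.2
    · exact fun _ => Or.inr ⟨mem_pair i, mem_pair j⟩
  · rintro (rfl | ⟨rfl | rfl, rfl | rfl⟩) <;> rfl

theorem dbl0_ne_dbl1 : dbl0 u ≠ dbl1 u := fun h => Bool.false_ne_true (Sum.inr_injective h)

variable [Lattice L]

theorem dle_refl (x : Doubled L u) : dle u x x := by
  rcases x with x | i
  · exact le_refl (x : L)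
  · exact le_refl i

theorem dle_trans {x y z : Doubled L u} (hxy : dle u x y) (hyz : dle u y z) : dle u x z := by
  rcases x with x | i <;> rcases y with y | j <;> rcases z with z | k
  · exact le_trans (α := L) hxy hyz
  · exact le_trans (α := L) hxy hyz
  · exact le_trans (α := L) hxy hyz
  · exact hxy
  · exact le_trans (α := L) hxy hyz
  · exact absurd (le_antisymm (α := L) hyz hxy) y.2
  · exact hyz
  · exact le_trans (α := Bool) hxy hyz

theorem dle_antisymm {x y : Doubled L u} (hxy : dle u x y) (hyx : dle u y x) : x = y := by
  rcases x with x | i <;> rcases y with y | j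
  · exact congrArg Sum.inl (Subtype.ext (le_antisymm (α := L) hxy hyx))
  · exact absurd (le_antisymm (α := L) hxy hyx) x.2
  · exact absurd (le_antisymm (α := L) hyx hxy) y.2
  · exact congrArg Sum.inr (le_antisymm (α := Bool) hxy hyx)

theorem dproj_le_of_dle {x y : Doubled L u} (h : dle u x y) : dproj u x ≤ dproj u y := by
  rcases x with x | i <;> rcases y with y | j
  · exact h
  · exact h
  · exact h
  · exact le_refl u

theorem dle_or_dle_of_dproj_le {x y : Doubled L u} (h : dproj u x ≤ dproj u y) :
    dle u x y ∨ dle u y x := by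
  rcases x with x | i <;> rcases y with y | j
  · exact Or.inl h
  · exact Or.inl h
  · exact Or.inl h
  · exact le_total i j

theorem dle_of_dproj_lt {x y : Doubled L u} (h : dproj u x < dproj u y) : dle u x y :=
  (dle_or_dle_of_dproj_le h.le).resolve_right fun h' => h.not_ge (dproj_le_of_dle h')

/-- `iota0 u` is the lower adjoint of `dproj u`. -/
theorem iota0_dle_iff {s : L} {z : Doubled L u} : dle u (iota0 u s) z ↔ s ≤ dproj u z := by
  refine ⟨fun h => by simpa using dproj_le_of_dle h, fun h => ?_⟩
  rcases eq_or_ne s u with rfl | hs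
  · rw [iota0_self]
    rcases z with z | i
    · exact h
    · exact Bool.false_le i
  · rw [iota0_of_ne hs]
    rcases z with z | i
    · exact h
    · exact h

/-- `iota1 u` is the upper adjoint of `dproj u`. -/
theorem dle_iota1_iff {s : L} {z : Doubled L u} : dle u z (iota1 u s) ↔ dproj u z ≤ s := by
  refine ⟨fun h => by simpa using dproj_le_of_dle h, fun h => ?_⟩
  rcases eq_or_ne s u with rfl | hs
  · rw [iota1_self]
    rcases z with z | i
    · exact h
    · exact Bool.le_true i
  · rw [iota1_of_ne hs]
    rcases z with z | i
    · exact h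
    · exact h

section
open Classical

/-- The join of `L[u]`. -/
noncomputable def dsup (x y : Doubled L u) : Doubled L u :=
  if dle u x y then y else if dle u y x then x else iota0 u (dproj u x ⊔ dproj u y)

/-- The meet of `L[u]`. -/
noncomputable def dinf (x y : Doubled L u) : Doubled L u :=
  if dle u x y then x else if dle u y x then y else iota1 u (dproj u x ⊓ dproj u y)

theorem dle_dsup_left (x y : Doubled L u) : dle u x (dsup x y) := by
  unfold dsup
  split_ifs with hxy hyx
  · exact hxy
  · exact dle_refl x
  · refine dle_of_dproj_lt ?_
    rw [dproj_iota0, left_lt_sup]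
    exact fun h => (dle_or_dle_of_dproj_le h).elim hyx hxy

theorem dle_dsup_right (x y : Doubled L u) : dle u y (dsup x y) := by
  unfold dsup
  split_ifs with hxy hyx
  · exact dle_refl y
  · exact hyx
  · refine dle_of_dproj_lt ?_
    rw [dproj_iota0, right_lt_sup]
    exact fun h => (dle_or_dle_of_dproj_le h).elim hxy hyx

theorem dsup_dle {x y z : Doubled L u} (hxz : dle u x z) (hyz : dle u y z) :
    dle u (dsup x y) z := by
  unfold dsup
  split_ifs
  · exact hyz
  · exact hxz
  · exact iota0_dle_iff.2 (sup_le (dproj_le_of_dle hxz) (dproj_le_of_dle hyz))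

theorem dinf_dle_left (x y : Doubled L u) : dle u (dinf x y) x := by
  unfold dinf
  split_ifs with hxy hyx
  · exact dle_refl x
  · exact hyx
  · refine dle_of_dproj_lt ?_
    rw [dproj_iota1, inf_lt_left]
    exact fun h => (dle_or_dle_of_dproj_le h).elim hxy hyx

theorem dinf_dle_right (x y : Doubled L u) : dle u (dinf x y) y := by
  unfold dinf
  split_ifs with hxy hyx
  · exact hxy
  · exact dle_refl y
  · refine dle_of_dproj_lt ?_
    rw [dproj_iota1, inf_lt_right]
    exact fun h => (dle_or_dle_of_dproj_le h).elim hyx hxy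

theorem dle_dinf {x y z : Doubled L u} (hzx : dle u z x) (hzy : dle u z y) :
    dle u z (dinf x y) := by
  unfold dinf
  split_ifs
  · exact hzx
  · exact hzy
  · exact dle_iota1_iff.2 (le_inf (dproj_le_of_dle hzx) (dproj_le_of_dle hzy))

end

/-- The lattice structure on `L[u]` with order `dle u`. -/
@[reducible]
noncomputable def lattice (u : L) : Lattice (Doubled L u) where
  le := dle u
  le_refl := dle_refl
  le_trans _ _ _ := dle_trans
  le_antisymm _ _ := dle_antisymm
  sup := dsup
  le_sup_left := dle_dsup_left
  le_sup_right := dle_dsup_right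
  sup_le _ _ _ := dsup_dle
  inf := dinf
  inf_le_left := dinf_dle_left
  inf_le_right := dinf_dle_right
  le_inf _ _ _ := dle_dinf

section

variable [Lattice (Doubled L u)] (hle : ∀ x y : Doubled L u, x ≤ y ↔ dle u x y)
include hle

theorem gc_iota0_dproj : GaloisConnection (iota0 u) (dproj u) :=
  fun _ _ => (hle _ _).trans iota0_dle_iff

theorem gc_dproj_iota1 : GaloisConnection (dproj u) (iota1 u) :=
  fun _ _ => dle_iota1_iff.symm.trans (hle _ _).symm

theorem dproj_sup (x y : Doubled L u) : dproj u (x ⊔ y) = dproj u x ⊔ dproj u y :=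
  (gc_dproj_iota1 hle).l_sup

theorem dproj_inf (x y : Doubled L u) : dproj u (x ⊓ y) = dproj u x ⊓ dproj u y :=
  (gc_iota0_dproj hle).u_inf

theorem dbl0_le_dbl1 : dbl0 u ≤ dbl1 u :=
  (hle _ _).2 (Bool.false_le true)

theorem dbl1_le_of_dbl0_lt {x : Doubled L u} (h : dbl0 u < x) : dbl1 u ≤ x := by
  rw [hle]
  rcases x with x | _ | _
  · have h' := (hle (dbl0 u) (Sum.inl x)).1 h.le
    exact h'
  · exact absurd rfl h.ne
  · exact dle_refl _

theorem le_dbl0_of_lt_dbl1 {x : Doubled L u} (h : x < dbl1 u) : x ≤ dbl0 u := by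
  rw [hle]
  rcases x with x | _ | _
  · have h' := (hle (Sum.inl x) (dbl1 u)).1 h.le
    exact h'
  · exact dle_refl _
  · exact absurd rfl h.ne

theorem dbl0_lt_dbl1 : dbl0 u < dbl1 u :=
  lt_of_le_of_ne (dbl0_le_dbl1 hle) dbl0_ne_dbl1

theorem infIrred_dbl0 : InfIrred (dbl0 u) := by
  refine ⟨fun h => h.not_lt (dbl0_lt_dbl1 hle), fun b c h => ?_⟩
  by_contra! hbc
  have hb := dbl1_le_of_dbl0_lt hle (lt_of_le_of_ne (h ▸ inf_le_left) hbc.1.symm)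
  have hc := dbl1_le_of_dbl0_lt hle (lt_of_le_of_ne (h ▸ inf_le_right) hbc.2.symm)
  exact (dbl0_lt_dbl1 hle).not_ge (h ▸ le_inf hb hc)

theorem supIrred_dbl1 : SupIrred (dbl1 u) := by
  refine ⟨fun h => h.not_lt (dbl0_lt_dbl1 hle), fun b c h => ?_⟩
  by_contra! hbc
  have hb := le_dbl0_of_lt_dbl1 hle (lt_of_le_of_ne (h ▸ le_sup_left) hbc.1)
  have hc := le_dbl0_of_lt_dbl1 hle (lt_of_le_of_ne (h ▸ le_sup_right) hbc.2)
  exact (dbl0_lt_dbl1 hle).not_ge (h ▸ sup_le hb hc)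

theorem dbl0_inf_inl (a : {x : L // x ≠ u}) :
    (dbl0 u ⊓ Sum.inl a : Doubled L u) = iota0 u (u ⊓ (a : L)) := by
  by_cases h : u ⊓ (a : L) = u
  · rw [h, iota0_self]
    exact inf_eq_left.2 ((hle _ _).2 (inf_eq_left.1 h))
  · exact eq_iota0_of_dproj_eq h (dproj_inf hle _ _)

theorem dbl1_sup_inl (a : {x : L // x ≠ u}) :
    (dbl1 u ⊔ Sum.inl a : Doubled L u) = iota1 u (u ⊔ (a : L)) := by
  by_cases h : u ⊔ (a : L) = u
  · rw [h, iota1_self]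
    exact sup_eq_left.2 ((hle _ _).2 (sup_eq_left.1 h))
  · exact eq_iota1_of_dproj_eq h (dproj_sup hle _ _)

theorem gen_dbl0_dbl1_iff (x y : Doubled L u) :
    (LatCon.gen (dbl0 u) (dbl1 u)).r x y ↔ dproj u x = dproj u y := by
  constructor
  · let ker : LatCon (Doubled L u) :=
      { r := fun x y => dproj u x = dproj u y
        refl' := fun _ => rfl
        symm' := Eq.symm
        trans' := Eq.trans
        sup' := fun h h' => by rw [dproj_sup hle, dproj_sup hle, h, h']
        inf' := fun h h' => by rw [dproj_inf hle, dproj_inf hle, h, h'] }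
    exact fun h => h ker rfl
  · intro h c hc
    rcases dproj_eq_dproj_iff.1 h with rfl | ⟨rfl | rfl, rfl | rfl⟩
    · exact c.refl' _
    · exact c.refl' _
    · exact hc
    · exact c.symm' hc
    · exact c.refl' _

end

end Doubled

/-- Properties of the doubling `L[u]` of an element `u` of a lattice `L`:
(i) `L[u]` is a lattice under the order `≤ᵤ` (`dle u`);
(ii) `u₀` is meet-irreducible, `u₁` is join-irreducible, and `u₁` covers `u₀`;
(iii) for `a, b, c ∈ L ∖ {u}`, joins (and dually meets) in `L` and `L[u]` agree;
(iv) for `a ≠ u`, the meet `u₀ ⊓ a` in `L[u]` is the meet `u ⊓ a` computed in `L`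
(under the map `iota0` sending `u` to `u₀`), and dually `u₁ ⊔ a` is `u ⊔ a`
(under `iota1`);
(v) the congruence `θ` generated by `(u₀, u₁)` has exactly one nontrivial class,
namely `{u₀, u₁}`, and `L[u]/θ ≅ L` via the projection `dproj u`. -/
theorem statement3 (L : Type) [Lattice L] (u : L) :
    -- (i)
    (∃ inst : Lattice (Doubled L u),
      ∀ x y : Doubled L u, lleOf inst x y ↔ dle u x y) ∧
    (∀ [instD : Lattice (Doubled L u)],
      (∀ x y : Doubled L u, x ≤ y ↔ dle u x y) →
      -- (ii)
      (InfIrred (dbl0 u) ∧ SupIrred (dbl1 u) ∧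
        dbl0 u ≤ dbl1 u ∧ dbl0 u ≠ dbl1 u ∧
        (∀ c : Doubled L u, dbl0 u ≤ c → c ≤ dbl1 u → c = dbl0 u ∨ c = dbl1 u)) ∧
      -- (iii)
      (∀ a b c : {x : L // x ≠ u},
        ((a : L) ⊔ (b : L) = (c : L) ↔
          (Sum.inl a ⊔ Sum.inl b : Doubled L u) = Sum.inl c) ∧
        ((a : L) ⊓ (b : L) = (c : L) ↔
          (Sum.inl a ⊓ Sum.inl b : Doubled L u) = Sum.inl c)) ∧
      -- (iv)
      (∀ a : {x : L // x ≠ u},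
        (dbl0 u ⊓ Sum.inl a : Doubled L u) = iota0 u (u ⊓ (a : L)) ∧
        (dbl1 u ⊔ Sum.inl a : Doubled L u) = iota1 u (u ⊔ (a : L))) ∧
      -- (v)
      (∀ x y : Doubled L u,
        (LatCon.gen (dbl0 u) (dbl1 u)).r x y ↔
          (x = y ∨ (x ∈ ({dbl0 u, dbl1 u} : Set (Doubled L u)) ∧
                    y ∈ ({dbl0 u, dbl1 u} : Set (Doubled L u))))) ∧
      Function.Surjective (dproj u) ∧
      (∀ x y : Doubled L u, dproj u x = dproj u y ↔ (LatCon.gen (dbl0 u) (dbl1 u)).r x y) ∧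
      (∀ x y : Doubled L u, dproj u (x ⊔ y) = dproj u x ⊔ dproj u y) ∧
      (∀ x y : Doubled L u, dproj u (x ⊓ y) = dproj u x ⊓ dproj u y)) := by
  refine ⟨⟨Doubled.lattice u, fun _ _ => Iff.rfl⟩, fun {_} hle => ?_⟩
  refine ⟨⟨Doubled.infIrred_dbl0 hle, Doubled.supIrred_dbl1 hle, Doubled.dbl0_le_dbl1 hle,
    Doubled.dbl0_ne_dbl1, fun c h0 h1 => ?_⟩, fun a b c => ⟨⟨fun h => ?_, fun h => ?_⟩,
    ⟨fun h => ?_, fun h => ?_⟩⟩, fun a => ⟨Doubled.dbl0_inf_inl hle a,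
    Doubled.dbl1_sup_inl hle a⟩,
    fun x y => (Doubled.gen_dbl0_dbl1_iff hle x y).trans Doubled.dproj_eq_dproj_iff,
    fun s => ⟨iota0 u s, Doubled.dproj_iota0 s⟩,
    fun x y => (Doubled.gen_dbl0_dbl1_iff hle x y).symm,
    Doubled.dproj_sup hle, Doubled.dproj_inf hle⟩
  · rcases h0.eq_or_lt with h | h
    · exact Or.inl h.symm
    · exact Or.inr (le_antisymm h1 (Doubled.dbl1_le_of_dbl0_lt hle h))
  · exact Doubled.eq_inl_of_dproj_eq ((Doubled.dproj_sup hle _ _).trans h)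
  · exact (Doubled.dproj_sup hle _ _).symm.trans (congrArg (dproj u) h)
  · exact Doubled.eq_inl_of_dproj_eq ((Doubled.dproj_inf hle _ _).trans h)
  · exact (Doubled.dproj_inf hle _ _).symm.trans (congrArg (dproj u) h)
end

section
/- If L is a semidistributive lattice and u ∈ L, then the doubled lattice L[u] is semidistributive. -/
section

variable {L : Type*} [Lattice L] {u : L} [Lattice (Doubled L u)]

/-- The projection `L[u] → L` is left adjoint to `iota1`. -/
theorem gc_dproj_iota1 (hord : ∀ x y : Doubled L u, x ≤ y ↔ dle u x y) :
    GaloisConnection (dproj u) (iota1 u) := by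
  intro x v
  rw [hord]
  by_cases h : v = u
  · subst h
    rw [show iota1 v v = dbl1 v from dif_pos rfl]
    rcases x with x | i
    · exact Iff.rfl
    · exact iff_of_true le_rfl (Bool.le_true i)
  · rw [show iota1 u v = Sum.inl ⟨v, h⟩ from dif_neg h]
    rcases x with x | i <;> exact Iff.rfl

/-- The projection `L[u] → L` is right adjoint to `iota0`. -/
theorem gc_iota0_dproj (hord : ∀ x y : Doubled L u, x ≤ y ↔ dle u x y) :
    GaloisConnection (iota0 u) (dproj u) := by
  intro v x
  rw [hord]
  by_cases h : v = u
  · subst h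
    rw [show iota0 v v = dbl0 v from dif_pos rfl]
    rcases x with x | i
    · exact Iff.rfl
    · exact iff_of_true (Bool.false_le i) le_rfl
  · rw [show iota0 u v = Sum.inl ⟨v, h⟩ from dif_neg h]
    rcases x with x | i <;> exact Iff.rfl

/-- Two comparable elements of `L[u]` with the same projection are equal, unless they
are `u₀` and `u₁`. -/
theorem eq_or_of_dproj_eq (hord : ∀ x y : Doubled L u, x ≤ y ↔ dle u x y)
    {s t : Doubled L u} (hst : s ≤ t) (h : dproj u s = dproj u t) :
    s = t ∨ s = dbl0 u ∧ t = dbl1 u := by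
  rcases s with s | i <;> rcases t with t | j
  · exact Or.inl (congrArg Sum.inl (Subtype.ext h))
  · exact absurd h s.2
  · exact absurd h.symm t.2
  · have hij : i ≤ j := (hord _ _).1 hst
    cases i <;> cases j
    · exact Or.inl rfl
    · exact Or.inr ⟨rfl, rfl⟩
    · exact absurd hij (by decide)
    · exact Or.inl rfl

/-- The element `u₁` has `u₀` as its unique lower cover. -/
theorem eq_dbl1_or_le_dbl0 (hord : ∀ x y : Doubled L u, x ≤ y ↔ dle u x y)
    {x : Doubled L u} (h : x ≤ dbl1 u) : x = dbl1 u ∨ x ≤ dbl0 u := by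
  rcases x with x | i
  · exact Or.inr ((hord _ _).2 (show (x : L) ≤ u from (hord _ _).1 h))
  · cases i
    · exact Or.inr le_rfl
    · exact Or.inl rfl

/-- The element `u₀` has `u₁` as its unique upper cover. -/
theorem eq_dbl0_or_dbl1_le (hord : ∀ x y : Doubled L u, x ≤ y ↔ dle u x y)
    {x : Doubled L u} (h : dbl0 u ≤ x) : x = dbl0 u ∨ dbl1 u ≤ x := by
  rcases x with x | i
  · exact Or.inr ((hord _ _).2 (show u ≤ (x : L) from (hord _ _).1 h))
  · cases i
    · exact Or.inl rfl
    · exact Or.inr le_rfl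

theorem dbl0_le_dbl1 (hord : ∀ x y : Doubled L u, x ≤ y ↔ dle u x y) : dbl0 u ≤ dbl1 u :=
  (hord _ _).2 (Bool.false_le true)

theorem not_dbl1_le_dbl0 (hord : ∀ x y : Doubled L u, x ≤ y ↔ dle u x y) :
    ¬ dbl1 u ≤ dbl0 u := fun h =>
  absurd (show true ≤ false from (hord _ _).1 h) (by decide)

theorem joinSD_doubled (hL : SD L) (hord : ∀ x y : Doubled L u, x ≤ y ↔ dle u x y) :
    JoinSD (Doubled L u) := by
  intro t x y z hy hz
  have hsup := fun a b : Doubled L u => (gc_dproj_iota1 hord).l_sup (a₁ := a) (a₂ := b)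
  have hinf := fun a b : Doubled L u => (gc_iota0_dproj hord).u_inf (b₁ := a) (b₂ := b)
  have hle : x ⊔ (y ⊓ z) ≤ t := hy ▸ sup_le_sup_left inf_le_left x
  have hπ : dproj u (x ⊔ (y ⊓ z)) = dproj u t := by
    rw [hsup, hinf]
    exact (hL.1 _ _ _ _ (hy ▸ hsup x y) (hz ▸ hsup x z)).symm
  rcases eq_or_of_dproj_eq hord hle hπ with h | ⟨hs, rfl⟩
  · exact h.symm
  have hx : x ≤ dbl0 u := hs ▸ le_sup_left
  have top_of : ∀ w : Doubled L u, dbl1 u = x ⊔ w → w = dbl1 u := fun w hw =>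
    (eq_dbl1_or_le_dbl0 hord (hw ▸ le_sup_right)).resolve_right fun hw0 =>
      not_dbl1_le_dbl0 hord (hw ▸ sup_le hx hw0)
  rw [top_of y hy, top_of z hz, inf_idem]
  exact (sup_eq_right.2 (hx.trans (dbl0_le_dbl1 hord))).symm

theorem meetSD_doubled (hL : SD L) (hord : ∀ x y : Doubled L u, x ≤ y ↔ dle u x y) :
    MeetSD (Doubled L u) := by
  intro t x y z hy hz
  have hsup := fun a b : Doubled L u => (gc_dproj_iota1 hord).l_sup (a₁ := a) (a₂ := b)
  have hinf := fun a b : Doubled L u => (gc_iota0_dproj hord).u_inf (b₁ := a) (b₂ := b)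
  have hle : t ≤ x ⊓ (y ⊔ z) := hy ▸ inf_le_inf_left x le_sup_left
  have hπ : dproj u t = dproj u (x ⊓ (y ⊔ z)) := by
    rw [hinf, hsup]
    exact hL.2 _ _ _ _ (hy ▸ hinf x y) (hz ▸ hinf x z)
  rcases eq_or_of_dproj_eq hord hle hπ with h | ⟨rfl, hs⟩
  · exact h
  have hx : dbl1 u ≤ x := hs ▸ inf_le_left
  have bot_of : ∀ w : Doubled L u, dbl0 u = x ⊓ w → w = dbl0 u := fun w hw =>
    (eq_dbl0_or_dbl1_le hord (hw ▸ inf_le_right)).resolve_right fun hw1 =>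
      not_dbl1_le_dbl0 hord (hw ▸ le_inf hx hw1)
  rw [bot_of y hy, bot_of z hz, sup_idem]
  exact (inf_eq_right.2 ((dbl0_le_dbl1 hord).trans hx)).symm

end

/-! ### STATEMENT 4 -/

/-- If `L` is a semidistributive lattice and `u ∈ L`, then the doubled lattice
`L[u]` is semidistributive. -/
theorem statement4 (L : Type) [Lattice L] (u : L) (hL : SD L)
    [instD : Lattice (Doubled L u)]
    (hord : ∀ x y : Doubled L u, x ≤ y ↔ dle u x y) :
    SD (Doubled L u) := by
  exact ⟨joinSD_doubled hL hord, meetSD_doubled hL hord⟩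
end

section
/- Let L be a lattice and u ∈ L, and let θ be the congruence of the doubled lattice L[u] generated by the pair (u₀, u₁). Then θ is an atom in the congruence lattice Con L[u]; that is, θ is strictly above the equality relation and no congruence of L[u] lies strictly between the equality relation and θ. -/
section

variable {L : Type*} [Lattice L] {u : L} [Lattice (Doubled L u)]

/-- The kernel of the projection `L[u] → L`. -/
def dprojKer (hord : ∀ x y : Doubled L u, x ≤ y ↔ dle u x y) : LatCon (Doubled L u) where
  r x y := dproj u x = dproj u y
  refl' _ := rfl
  symm' := Eq.symm
  trans' := Eq.trans
  sup' h h' := by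
    rw [(gc_dproj_iota1 hord).l_sup, (gc_dproj_iota1 hord).l_sup, h, h']
  inf' h h' := by
    rw [(gc_iota0_dproj hord).u_inf, (gc_iota0_dproj hord).u_inf, h, h']

end

/-- Distinct elements with the same projection are `u₀` and `u₁`, in some order. -/
theorem eq_dbl_of_dproj_eq {L : Type*} {u : L} {x y : Doubled L u}
    (h : dproj u x = dproj u y) (hne : x ≠ y) :
    (x = dbl0 u ∧ y = dbl1 u) ∨ (x = dbl1 u ∧ y = dbl0 u) := by
  rcases x with x | i <;> rcases y with y | j
  · exact absurd (congrArg Sum.inl (Subtype.ext h)) hne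
  · exact absurd h x.2
  · exact absurd h.symm y.2
  · cases i <;> cases j
    · exact absurd rfl hne
    · exact Or.inl ⟨rfl, rfl⟩
    · exact Or.inr ⟨rfl, rfl⟩
    · exact absurd rfl hne

/-! ### STATEMENT 5 -/

/-- The congruence `θ` of `L[u]` generated by the pair `(u₀, u₁)` is an atom of the
congruence lattice `Con L[u]`: it is strictly above the equality relation `⊥` and
nothing lies strictly between `⊥` and `θ`. -/
theorem statement5 (L : Type) [Lattice L] (u : L)
    [instD : Lattice (Doubled L u)]
    (hord : ∀ x y : Doubled L u, x ≤ y ↔ dle u x y) :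
    IsAtom (LatCon.gen (dbl0 u) (dbl1 u)) := by
  refine ⟨fun h => ?_, fun c hc => ?_⟩
  · have h01 : (LatCon.gen (dbl0 u) (dbl1 u)).r (dbl0 u) (dbl1 u) := fun _ hc => hc
    rw [h] at h01
    exact Bool.false_ne_true (Sum.inr.inj h01)
  · refine le_bot_iff.mp fun x y hxy => ?_
    by_contra hne
    have hc01 : c.r (dbl0 u) (dbl1 u) := by
      rcases eq_dbl_of_dproj_eq (hc.le x y hxy (dprojKer hord) rfl) hne with
        ⟨rfl, rfl⟩ | ⟨rfl, rfl⟩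
      · exact hxy
      · exact c.symm' hxy
    exact hc.not_ge fun _ _ h => h c hc01
end

section
/- Let F be an FN lattice (a simple, infinite, semidistributive lattice) and let u ∈ F. Then the doubled lattice F[u] is an infinite semidistributive lattice whose congruence lattice Con F[u] is a three-element chain, the unique nontrivial proper congruence being the congruence θ generated by (u₀, u₁), whose only nontrivial class is {u₀, u₁}. -/
/-! ### Simple semidistributive lattices have no least and no greatest element -/

theorem MeetSD.sup_inf_eq_bot_iff {L : Type*} [Lattice L] (hL : MeetSD L) {b : L}
    (hb : IsBot b) (x y c : L) : (x ⊔ y) ⊓ c = b ↔ x ⊓ c = b ∧ y ⊓ c = b := by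
  refine ⟨fun h => ⟨?_, ?_⟩, fun ⟨h, h'⟩ => ?_⟩
  · exact le_antisymm (h ▸ inf_le_inf_right c le_sup_left) (hb _)
  · exact le_antisymm (h ▸ inf_le_inf_right c le_sup_right) (hb _)
  · rw [inf_comm] at h h' ⊢
    exact (hL b c x y h.symm h'.symm).symm

namespace LatCon

variable {L : Type*} [Lattice L]

/-- A congruence of the order dual, seen as a congruence of the lattice itself. -/
def ofOrderDual (c : LatCon Lᵒᵈ) : LatCon L where
  r x y := c.r (OrderDual.toDual x) (OrderDual.toDual y)
  refl' x := c.refl' _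
  symm' h := c.symm' h
  trans' h h' := c.trans' h h'
  sup' h h' := c.inf' h h'
  inf' h h' := c.sup' h h'

/-- The congruence relating `x` and `y` when they have the same meet-annihilators with respect
to a least element `b`. -/
def glivenko (hL : MeetSD L) {b : L} (hb : IsBot b) : LatCon L where
  r x y := ∀ c, x ⊓ c = b ↔ y ⊓ c = b
  refl' _ _ := Iff.rfl
  symm' h c := (h c).symm
  trans' h h' c := (h c).trans (h' c)
  sup' := by
    intro x y x' y' h h' c
    rw [hL.sup_inf_eq_bot_iff hb, hL.sup_inf_eq_bot_iff hb, h, h']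
  inf' := by
    intro x y x' y' h h' c
    rw [inf_assoc, h, inf_left_comm, h', inf_left_comm, ← inf_assoc]

end LatCon

theorem IsSimpleLat.orderDual {L : Type*} [Lattice L] (h : IsSimpleLat L) :
    IsSimpleLat Lᵒᵈ := by
  obtain ⟨⟨x, y, hxy⟩, h⟩ := h
  refine ⟨⟨OrderDual.toDual x, OrderDual.toDual y, hxy⟩, fun c => ?_⟩
  have key : ∀ d : LatCon L, c.ofOrderDual = d → ∀ x y : L,
      c.r (OrderDual.toDual x) (OrderDual.toDual y) = d.r x y := by
    rintro d rfl x y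
    rfl
  refine (h c.ofOrderDual).imp (fun e => ?_) (fun e => ?_)
  · ext x y
    exact iff_of_eq (key _ e x y)
  · ext x y
    exact iff_of_eq (key _ e x y)

theorem IsFN.orderDual {L : Type*} [Lattice L] (h : IsFN L) : IsFN Lᵒᵈ :=
  ⟨h.1, h.2.1.orderDual, fun w x y z => h.2.2.2 w x y z, fun w x y z => h.2.2.1 w x y z⟩

/-- In a simple lattice in which meets distribute over joins, every element is extremal. -/
theorem IsSimpleLat.isBot_or_isTop {L : Type*} [Lattice L] (h : IsSimpleLat L)
    (hd : ∀ x y z : L, (x ⊔ y) ⊓ z = (x ⊓ z) ⊔ (y ⊓ z)) (a : L) : IsBot a ∨ IsTop a := by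
  let c : LatCon L :=
    { r := fun x y => x ⊓ a = y ⊓ a
      refl' := fun _ => rfl
      symm' := Eq.symm
      trans' := Eq.trans
      sup' := by
        intro x y x' y' h h'
        rw [hd, hd, h, h']
      inf' := by
        intro x y x' y' h h'
        rw [inf_inf_distrib_right, h, h', ← inf_inf_distrib_right] }
  rcases h.2 c with hc | hc
  · right
    intro x
    have h1 : c.r x (x ⊓ a) := by
      change x ⊓ a = x ⊓ a ⊓ a
      rw [inf_assoc, inf_idem]
    rw [hc] at h1
    exact inf_eq_left.mp (Eq.symm h1)
  · left
    intro x
    have h1 : c.r x a := by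
      rw [hc]
      trivial
    change x ⊓ a = a ⊓ a at h1
    rw [inf_idem] at h1
    exact inf_eq_right.mp h1

theorem IsFN.not_isBot {L : Type*} [Lattice L] (h : IsFN L) (b : L) : ¬ IsBot b := by
  intro hb
  obtain ⟨hinf, hs, -, hm⟩ := h
  have hG : LatCon.glivenko hm hb = ⊥ := by
    refine (hs.2 _).resolve_right fun e => ?_
    have hall : ∀ x : L, x = b := by
      intro x
      have h1 : (LatCon.glivenko hm hb).r b x := by
        rw [e]
        trivial
      have h2 := (h1 x).mp (inf_eq_left.mpr (hb x))
      rwa [inf_idem] at h2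
    obtain ⟨x, y, hxy⟩ := hs.1
    exact hxy ((hall x).trans (hall y).symm)
  have hd : ∀ x y z : L, (x ⊔ y) ⊓ z = (x ⊓ z) ⊔ (y ⊓ z) := by
    intro x y z
    have h1 : (LatCon.glivenko hm hb).r ((x ⊔ y) ⊓ z) ((x ⊓ z) ⊔ (y ⊓ z)) := by
      intro c
      rw [inf_assoc, hm.sup_inf_eq_bot_iff hb, hm.sup_inf_eq_bot_iff hb, inf_assoc, inf_assoc]
    rw [hG] at h1
    exact h1
  have hfin : ∀ x y z : L, x = y ∨ y = z ∨ x = z := by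
    intro x y z
    rcases hs.isBot_or_isTop hd x with hx | hx <;> rcases hs.isBot_or_isTop hd y with hy | hy <;>
      rcases hs.isBot_or_isTop hd z with hz | hz
    all_goals first
      | exact Or.inl (le_antisymm (hx y) (hy x))
      | exact Or.inl (le_antisymm (hy x) (hx y))
      | exact Or.inr (Or.inl (le_antisymm (hy z) (hz y)))
      | exact Or.inr (Or.inl (le_antisymm (hz y) (hy z)))
      | exact Or.inr (Or.inr (le_antisymm (hx z) (hz x)))
      | exact Or.inr (Or.inr (le_antisymm (hz x) (hx z)))
  have f := Infinite.natEmbedding L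
  have hf : ∀ m n, f m = f n → m = n := fun m n e => f.injective e
  rcases hfin (f 0) (f 1) (f 2) with e | e | e <;> simpa using hf _ _ e

theorem IsFN.not_isTop {L : Type*} [Lattice L] (h : IsFN L) (t : L) : ¬ IsTop t := fun ht =>
  h.orderDual.not_isBot (OrderDual.toDual t) fun x => ht (OrderDual.ofDual x)

/-- No element of an FN lattice is comparable with all others. -/
theorem IsFN.exists_incomparable {L : Type*} [Lattice L] (h : IsFN L) (u : L) :
    ∃ x, ¬ x ≤ u ∧ ¬ u ≤ x := by
  by_contra! hcomp
  have hor : ∀ x, x ≤ u ∨ u ≤ x := fun x => or_iff_not_imp_left.mpr (hcomp x)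
  have hdist : ∀ x y : L, x ⊓ y ⊔ u = (x ⊔ u) ⊓ (y ⊔ u) := by
    intro x y
    rcases hor x with hx | hx
    · rw [sup_eq_right.mpr hx, sup_eq_right.mpr (inf_le_left.trans hx),
        inf_eq_left.mpr le_sup_right]
    rcases hor y with hy | hy
    · rw [sup_eq_right.mpr hy, sup_eq_right.mpr (inf_le_right.trans hy),
        inf_eq_right.mpr le_sup_right]
    · rw [sup_eq_left.mpr hx, sup_eq_left.mpr hy, sup_eq_left.mpr (le_inf hx hy)]
  let c : LatCon L :=
    { r := fun x y => x ⊔ u = y ⊔ u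
      refl' := fun _ => rfl
      symm' := Eq.symm
      trans' := Eq.trans
      sup' := by
        intro x y x' y' h h'
        rw [sup_sup_distrib_right, sup_sup_distrib_right y, h, h']
      inf' := by
        intro x y x' y' h h'
        rw [hdist, hdist, h, h'] }
  rcases h.2.1.2 c with hc | hc
  · refine h.not_isBot u fun x => ?_
    have h1 : c.r (x ⊓ u) u := by
      change x ⊓ u ⊔ u = u ⊔ u
      simp
    rw [hc] at h1
    exact inf_eq_right.mp h1
  · refine h.not_isTop u fun x => ?_
    have h1 : c.r x u := by
      rw [hc]
      trivial
    change x ⊔ u = u ⊔ u at h1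
    rw [sup_idem] at h1
    exact sup_eq_right.mp h1

/-! ### Joins of congruences -/

namespace LatCon

variable {L : Type*} [Lattice L]

/-- The join of two congruences, as the equivalence closure of their union. -/
def eqvJoin (c d : LatCon L) : LatCon L where
  r := Relation.EqvGen fun x y => c.r x y ∨ d.r x y
  refl' := Relation.EqvGen.refl
  symm' h := h.symm
  trans' h h' := h.trans _ _ _ h'
  sup' := by
    have key : ∀ {x y : L} (z : L), Relation.EqvGen (fun x y => c.r x y ∨ d.r x y) x y →
        Relation.EqvGen (fun x y => c.r x y ∨ d.r x y) (x ⊔ z) (y ⊔ z) := by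
      intro x y z h
      induction h with
      | rel x y h => exact .rel _ _ (h.imp (fun h => c.sup' h (c.refl' z))
          (fun h => d.sup' h (d.refl' z)))
      | refl x => exact .refl _
      | symm x y _ ih => exact .symm _ _ ih
      | trans x y w _ _ ih ih' => exact .trans _ _ _ ih ih'
    intro x y x' y' h h'
    refine (key x' h).trans _ _ _ ?_
    rw [sup_comm y, sup_comm y]
    exact key y h'
  inf' := by
    have key : ∀ {x y : L} (z : L), Relation.EqvGen (fun x y => c.r x y ∨ d.r x y) x y →
        Relation.EqvGen (fun x y => c.r x y ∨ d.r x y) (x ⊓ z) (y ⊓ z) := by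
      intro x y z h
      induction h with
      | rel x y h => exact .rel _ _ (h.imp (fun h => c.inf' h (c.refl' z))
          (fun h => d.inf' h (d.refl' z)))
      | refl x => exact .refl _
      | symm x y _ ih => exact .symm _ _ ih
      | trans x y w _ _ ih ih' => exact .trans _ _ _ ih ih'
    intro x y x' y' h h'
    refine (key x' h).trans _ _ _ ?_
    rw [inf_comm y, inf_comm y]
    exact key y h'

theorem le_eqvJoin_left (c d : LatCon L) : c ≤ eqvJoin c d :=
  fun _ _ h => .rel _ _ (Or.inl h)

theorem le_eqvJoin_right (c d : LatCon L) : d ≤ eqvJoin c d :=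
  fun _ _ h => .rel _ _ (Or.inr h)

end LatCon

/-! ### The doubling -/

theorem iota0_self {L : Type*} (u : L) : iota0 u u = dbl0 u := dif_pos rfl

theorem iota0_of_ne {L : Type*} {u t : L} (h : t ≠ u) : iota0 u t = Sum.inl ⟨t, h⟩ := dif_neg h

theorem iota1_self {L : Type*} (u : L) : iota1 u u = dbl1 u := dif_pos rfl

theorem iota1_of_ne {L : Type*} {u t : L} (h : t ≠ u) : iota1 u t = Sum.inl ⟨t, h⟩ := dif_neg h

theorem dproj_iota0 {L : Type*} {u : L} (t : L) : dproj u (iota0 u t) = t := by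
  by_cases h : t = u
  · subst h
    rw [iota0_self]
    rfl
  · rw [iota0_of_ne h]
    rfl

theorem dproj_eq_iff {L : Type*} {u : L} {x y : Doubled L u} :
    dproj u x = dproj u y ↔ x = y ∨
      (x ∈ ({dbl0 u, dbl1 u} : Set (Doubled L u)) ∧
        y ∈ ({dbl0 u, dbl1 u} : Set (Doubled L u))) := by
  have hb : ∀ b : Bool, (Sum.inr b : Doubled L u) ∈ ({dbl0 u, dbl1 u} : Set (Doubled L u)) := by
    rintro (_ | _)
    · exact Or.inl rfl
    · exact Or.inr rfl
  constructor
  · intro h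
    rcases x with ⟨x, hx⟩ | i <;> rcases y with ⟨y, hy⟩ | j
    · left
      exact congrArg Sum.inl (Subtype.ext h)
    · exact absurd h hx
    · exact absurd h.symm hy
    · exact Or.inr ⟨hb i, hb j⟩
  · rintro (rfl | ⟨rfl | rfl, rfl | rfl⟩) <;> rfl

theorem dbl0_ne_dbl1 {L : Type*} {u : L} : dbl0 u ≠ dbl1 u := by
  intro h
  exact Bool.false_ne_true (Sum.inr.inj h)

section Doubling

variable {L : Type*} [Lattice L] {u : L} [Lattice (Doubled L u)]

theorem le_dbl1_iff (hord : ∀ x y : Doubled L u, x ≤ y ↔ dle u x y) {x : Doubled L u} :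
    x ≤ dbl1 u ↔ x = dbl1 u ∨ x ≤ dbl0 u := by
  refine ⟨fun h => ?_, ?_⟩
  · rcases x with x | _ | _
    · exact Or.inr ((hord _ (dbl0 u)).mpr ((hord _ (dbl1 u)).mp h))
    · exact Or.inr le_rfl
    · exact Or.inl rfl
  · rintro (rfl | h)
    · exact le_rfl
    · exact h.trans (dbl0_le_dbl1 hord)

theorem dbl0_le_iff (hord : ∀ x y : Doubled L u, x ≤ y ↔ dle u x y) {x : Doubled L u} :
    dbl0 u ≤ x ↔ x = dbl0 u ∨ dbl1 u ≤ x := by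
  refine ⟨fun h => ?_, ?_⟩
  · rcases x with x | _ | _
    · exact Or.inr ((hord (dbl1 u) _).mpr ((hord (dbl0 u) _).mp h))
    · exact Or.inl rfl
    · exact Or.inr le_rfl
  · rintro (rfl | h)
    · exact le_rfl
    · exact (dbl0_le_dbl1 hord).trans h

/-- Comparable elements with the same projection are equal or are `u₀ < u₁`. -/
theorem eq_or_of_le_of_dproj_eq (hord : ∀ x y : Doubled L u, x ≤ y ↔ dle u x y)
    {x y : Doubled L u} (hxy : x ≤ y) (h : dproj u x = dproj u y) :
    x = y ∨ (x = dbl0 u ∧ y = dbl1 u) := by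
  rcases dproj_eq_iff.mp h with h | ⟨rfl | rfl, rfl | rfl⟩
  · exact Or.inl h
  · exact Or.inl rfl
  · exact Or.inr ⟨rfl, rfl⟩
  · exact Or.inl (le_antisymm hxy (dbl0_le_dbl1 hord))
  · exact Or.inl rfl

theorem Doubled.joinSD (hord : ∀ x y : Doubled L u, x ≤ y ↔ dle u x y) (hL : JoinSD L) :
    JoinSD (Doubled L u) := by
  intro a x y z hy hz
  have hsup : ∀ p q : Doubled L u, dproj u (p ⊔ q) = dproj u p ⊔ dproj u q := fun _ _ =>
    (gc_dproj_iota1 hord).l_sup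
  have hinf : ∀ p q : Doubled L u, dproj u (p ⊓ q) = dproj u p ⊓ dproj u q := fun _ _ =>
    (gc_iota0_dproj hord).u_inf
  have hle : x ⊔ (y ⊓ z) ≤ a := hy ▸ sup_le_sup_left inf_le_left x
  have hp : dproj u (x ⊔ (y ⊓ z)) = dproj u a := by
    rw [hsup, hinf]
    exact (hL _ _ _ _ (by rw [← hsup, ← hy]) (by rw [← hsup, ← hz])).symm
  rcases eq_or_of_le_of_dproj_eq hord hle hp with h | ⟨h, rfl⟩
  · exact h.symm
  · have hx : x ≤ dbl0 u := h ▸ le_sup_left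
    have key : ∀ w, dbl1 u = x ⊔ w → w = dbl1 u := by
      intro w hw
      refine ((le_dbl1_iff hord).mp (hw ▸ le_sup_right)).resolve_right fun h0 => ?_
      exact dbl0_ne_dbl1 (le_antisymm (dbl0_le_dbl1 hord) (hw ▸ sup_le hx h0))
    rw [key y hy, key z hz, inf_idem]
    exact (sup_eq_right.mpr (hx.trans (dbl0_le_dbl1 hord))).symm

theorem Doubled.meetSD (hord : ∀ x y : Doubled L u, x ≤ y ↔ dle u x y) (hL : MeetSD L) :
    MeetSD (Doubled L u) := by
  intro a x y z hy hz
  have hsup : ∀ p q : Doubled L u, dproj u (p ⊔ q) = dproj u p ⊔ dproj u q := fun _ _ =>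
    (gc_dproj_iota1 hord).l_sup
  have hinf : ∀ p q : Doubled L u, dproj u (p ⊓ q) = dproj u p ⊓ dproj u q := fun _ _ =>
    (gc_iota0_dproj hord).u_inf
  have hle : a ≤ x ⊓ (y ⊔ z) := hy ▸ inf_le_inf_left x le_sup_left
  have hp : dproj u a = dproj u (x ⊓ (y ⊔ z)) := by
    rw [hinf, hsup]
    exact hL _ _ _ _ (by rw [← hinf, ← hy]) (by rw [← hinf, ← hz])
  rcases eq_or_of_le_of_dproj_eq hord hle hp with h | ⟨rfl, h⟩
  · exact h
  · have hx : dbl1 u ≤ x := h ▸ inf_le_left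
    have key : ∀ w, dbl0 u = x ⊓ w → w = dbl0 u := by
      intro w hw
      refine ((dbl0_le_iff hord).mp (hw ▸ inf_le_right)).resolve_right fun h1 => ?_
      exact dbl0_ne_dbl1 (le_antisymm (dbl0_le_dbl1 hord) (hw ▸ le_inf hx h1))
    rw [key y hy, key z hz, sup_idem]
    exact (inf_eq_right.mpr ((dbl0_le_dbl1 hord).trans hx)).symm

theorem gen_dbl_eq_dprojKer (hord : ∀ x y : Doubled L u, x ≤ y ↔ dle u x y) :
    LatCon.gen (dbl0 u) (dbl1 u) = dprojKer hord := by
  refine le_antisymm (fun x y h => h _ rfl) (fun x y h c hc => ?_)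
  rcases dproj_eq_iff.mp h with rfl | ⟨rfl | rfl, rfl | rfl⟩
  · exact c.refl' _
  · exact c.refl' _
  · exact hc
  · exact c.symm' hc
  · exact c.refl' _

theorem eq_dprojKer_or_eq_top (hL : IsSimpleLat L)
    (hord : ∀ x y : Doubled L u, x ≤ y ↔ dle u x y) {d : LatCon (Doubled L u)}
    (hd : dprojKer hord ≤ d) : d = dprojKer hord ∨ d = ⊤ := by
  let c : LatCon L :=
    { r := fun s t => d.r (iota0 u s) (iota0 u t)
      refl' := fun _ => d.refl' _
      symm' := fun h => d.symm' h
      trans' := fun h h' => d.trans' h h'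
      sup' := by
        intro x y x' y' h h'
        rw [(gc_iota0_dproj hord).l_sup, (gc_iota0_dproj hord).l_sup]
        exact d.sup' h h'
      inf' := by
        intro x y x' y' h h'
        have key : ∀ s t : L, d.r (iota0 u (s ⊓ t)) (iota0 u s ⊓ iota0 u t) := by
          intro s t
          apply hd
          change dproj u _ = dproj u _
          rw [(gc_iota0_dproj hord).u_inf, dproj_iota0, dproj_iota0, dproj_iota0]
        exact d.trans' (key _ _) (d.trans' (d.inf' h h') (d.symm' (key _ _))) }
  have hiota : ∀ x : Doubled L u, d.r x (iota0 u (dproj u x)) := fun x =>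
    hd _ _ (dproj_iota0 _).symm
  rcases hL.2 c with hc | hc
  · left
    refine le_antisymm (fun x y h => ?_) hd
    have h1 : c.r (dproj u x) (dproj u y) :=
      d.trans' (d.symm' (hiota x)) (d.trans' h (hiota y))
    rw [hc] at h1
    exact h1
  · right
    refine top_le_iff.mp fun x y _ => ?_
    have h1 : c.r (dproj u x) (dproj u y) := by
      rw [hc]
      trivial
    exact d.trans' (hiota x) (d.trans' h1 (d.symm' (hiota y)))

theorem dbl_rel_of_ne_bot (hL : IsFN L)
    (hord : ∀ x y : Doubled L u, x ≤ y ↔ dle u x y) {d : LatCon (Doubled L u)}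
    (hd : d ≠ ⊥) : d.r (dbl0 u) (dbl1 u) := by
  by_cases hle : d ≤ dprojKer hord
  · by_contra hn
    refine hd (le_bot_iff.mp fun x y h => ?_)
    rcases dproj_eq_iff.mp (hle x y h) with h' | ⟨rfl | rfl, rfl | rfl⟩
    · exact h'
    · rfl
    · exact absurd h hn
    · exact absurd (d.symm' h) hn
    · rfl
  have htop : LatCon.eqvJoin d (dprojKer hord) = ⊤ := by
    refine (eq_dprojKer_or_eq_top hL.2.1 hord (LatCon.le_eqvJoin_right _ _)).resolve_left
      fun e => hle ?_
    exact (LatCon.le_eqvJoin_left d (dprojKer hord)).trans e.le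
  have hall : ∀ x y, (LatCon.eqvJoin d (dprojKer hord)).r x y := by
    intro x y
    rw [htop]
    trivial
  have h01 := dbl0_le_dbl1 hord
  have hsup : ∀ x y, d.r (x ⊔ dbl1 u) (y ⊔ dbl1 u) := by
    intro x y
    induction hall x y with
    | rel x y h =>
      rcases h with h | h
      · exact d.sup' h (d.refl' _)
      · rcases dproj_eq_iff.mp h with rfl | ⟨rfl | rfl, rfl | rfl⟩ <;>
          simp only [sup_idem, sup_eq_right.mpr h01, d.refl']
    | refl x => exact d.refl' _
    | symm x y _ ih => exact d.symm' ih
    | trans x y z _ _ ih ih' => exact d.trans' ih ih'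
  have hinf : ∀ x y, d.r (x ⊓ dbl0 u) (y ⊓ dbl0 u) := by
    intro x y
    induction hall x y with
    | rel x y h =>
      rcases h with h | h
      · exact d.inf' h (d.refl' _)
      · rcases dproj_eq_iff.mp h with rfl | ⟨rfl | rfl, rfl | rfl⟩ <;>
          simp only [inf_idem, inf_eq_right.mpr h01, d.refl']
    | refl x => exact d.refl' _
    | symm x y _ ih => exact d.symm' ih
    | trans x y z _ _ ih ih' => exact d.trans' ih ih'
  obtain ⟨t, htu, hut⟩ := hL.exists_incomparable u
  obtain ⟨x, hx⟩ : ∃ x : Doubled L u, dproj u x = t := ⟨_, dproj_iota0 t⟩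
  have hx1 : ¬ x ≤ dbl1 u := fun h => htu (hx ▸ (gc_dproj_iota1 hord).monotone_l h)
  have hx0 : ¬ dbl0 u ≤ x := fun h => hut (hx ▸ (gc_dproj_iota1 hord).monotone_l h)
  have hmeet : x ⊓ dbl1 u = x ⊓ dbl0 u := by
    refine le_antisymm (le_inf inf_le_left ?_) (inf_le_inf_left x h01)
    refine ((le_dbl1_iff hord).mp inf_le_right).resolve_left fun e => hx0 ?_
    exact h01.trans (inf_eq_right.mp e)
  have hjoin : x ⊔ dbl0 u = x ⊔ dbl1 u := by
    refine le_antisymm (sup_le_sup_left h01 x) (sup_le le_sup_left ?_)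
    refine ((dbl0_le_iff hord).mp le_sup_right).resolve_left fun e => hx1 ?_
    exact (sup_eq_right.mp e).trans h01
  have hs : d.r (x ⊔ dbl1 u) (dbl1 u) := by
    simpa using hsup x (dbl1 u)
  have hi : d.r (x ⊓ dbl0 u) (dbl0 u) := by
    simpa using hinf x (dbl0 u)
  have hx_0 : d.r x (dbl0 u) := by
    have h := d.inf' (d.refl' x) hs
    rw [inf_sup_self, hmeet] at h
    exact d.trans' h hi
  have hx_1 : d.r x (dbl1 u) := by
    have h := d.sup' (d.refl' x) hi
    rw [sup_inf_self, hjoin] at h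
    exact d.trans' h hs
  exact d.trans' (d.symm' hx_0) hx_1

end Doubling

/-! ### STATEMENT 7 -/

/-- Let `F` be an FN lattice and `u ∈ F`.  Then `F[u]` is an infinite
semidistributive lattice whose congruence lattice is a three-element chain, the
unique nontrivial proper congruence being the congruence `θ` generated by
`(u₀, u₁)`, whose only nontrivial class is `{u₀, u₁}`. -/
theorem statement7 (F : Type) [Lattice F] (hF : IsFN F) (u : F)
    [instD : Lattice (Doubled F u)]
    (hord : ∀ x y : Doubled F u, x ≤ y ↔ dle u x y) :
    Infinite (Doubled F u) ∧ SD (Doubled F u) ∧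
    Nonempty (LatCon (Doubled F u) ≃o Fin 3) ∧
    (LatCon.gen (dbl0 u) (dbl1 u) ≠ ⊥ ∧ LatCon.gen (dbl0 u) (dbl1 u) ≠ ⊤) ∧
    (∀ d : LatCon (Doubled F u), d ≠ ⊥ → d ≠ ⊤ → d = LatCon.gen (dbl0 u) (dbl1 u)) ∧
    (∀ x y : Doubled F u,
      (LatCon.gen (dbl0 u) (dbl1 u)).r x y ↔
        (x = y ∨ (x ∈ ({dbl0 u, dbl1 u} : Set (Doubled F u)) ∧
                  y ∈ ({dbl0 u, dbl1 u} : Set (Doubled F u))))) := by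
  have hker := gen_dbl_eq_dprojKer hord
  have hbot : LatCon.gen (dbl0 u) (dbl1 u) ≠ ⊥ := by
    intro e
    have h : (LatCon.gen (dbl0 u) (dbl1 u)).r (dbl0 u) (dbl1 u) := fun _ h => h
    rw [e] at h
    exact dbl0_ne_dbl1 h
  have htop : LatCon.gen (dbl0 u) (dbl1 u) ≠ ⊤ := by
    intro e
    obtain ⟨x, y, hxy⟩ := hF.2.1.1
    have h : (dprojKer hord).r (iota0 u x) (iota0 u y) := by
      rw [← hker, e]
      trivial
    change dproj u _ = dproj u _ at h
    rw [dproj_iota0, dproj_iota0] at h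
    exact hxy h
  have huniq : ∀ d : LatCon (Doubled F u), d ≠ ⊥ → d ≠ ⊤ →
      d = LatCon.gen (dbl0 u) (dbl1 u) := by
    intro d h0 h1
    have hle : LatCon.gen (dbl0 u) (dbl1 u) ≤ d := fun x y h =>
      h d (dbl_rel_of_ne_bot hF hord h0)
    rw [hker] at hle ⊢
    exact (eq_dprojKer_or_eq_top hF.2.1 hord hle).resolve_right h1
  refine ⟨?_, ⟨Doubled.joinSD hord hF.2.2.1, Doubled.meetSD hord hF.2.2.2⟩, ?_, ⟨hbot, htop⟩,
    huniq, ?_⟩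
  · have := hF.1
    exact Infinite.of_injective (iota0 u) (Function.LeftInverse.injective dproj_iota0)
  · let f : Fin 3 → LatCon (Doubled F u) := ![⊥, LatCon.gen (dbl0 u) (dbl1 u), ⊤]
    have hmono : StrictMono f := by
      rw [Fin.strictMono_iff_lt_succ]
      intro i
      fin_cases i
      · exact bot_lt_iff_ne_bot.mpr hbot
      · exact lt_top_iff_ne_top.mpr htop
    have hsurj : Function.Surjective f := by
      intro d
      by_cases h0 : d = ⊥
      · exact ⟨0, h0.symm⟩
      by_cases h1 : d = ⊤
      · exact ⟨2, h1.symm⟩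
      · exact ⟨1, (huniq d h0 h1).symm⟩
    exact ⟨(hmono.orderIsoOfSurjective f hsurj).symm⟩
  · intro x y
    rw [hker]
    exact dproj_eq_iff
end

section
/- There exists an infinite semidistributive lattice whose congruence lattice is a three-element chain (assuming the existence of an FN lattice, i.e., a simple, infinite, semidistributive lattice). -/
/-! ### The doubling of a point, as a subset of the product with `Prop` -/

/-- The doubling of the point `u`, realised as the pairs `(x, P)` in `L × Prop` such that `P`
holds if `u < x` and fails unless `u ≤ x`. Only `u` has two copies. -/
@[ext]
structure PointDoubling {L : Type*} [Lattice L] (u : L) where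
  val : L
  upper : Prop
  le_of_upper : upper → u ≤ val
  upper_of_lt : u < val → upper

namespace PointDoubling

variable {L : Type*} [Lattice L] {u : L}

instance : PartialOrder (PointDoubling u) where
  le p q := p.val ≤ q.val ∧ (p.upper → q.upper)
  le_refl _ := ⟨le_rfl, id⟩
  le_trans _ _ _ h₁ h₂ := ⟨h₁.1.trans h₂.1, h₂.2 ∘ h₁.2⟩
  le_antisymm _ _ h₁ h₂ :=
    PointDoubling.ext (le_antisymm h₁.1 h₂.1) (propext ⟨h₁.2, h₂.2⟩)

instance : Lattice (PointDoubling u) where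
  sup p q :=
    { val := p.val ⊔ q.val
      upper := p.upper ∨ q.upper ∨ u < p.val ⊔ q.val
      le_of_upper := by
        rintro (h | h | h)
        · exact le_sup_of_le_left (p.le_of_upper h)
        · exact le_sup_of_le_right (q.le_of_upper h)
        · exact h.le
      upper_of_lt := fun h => Or.inr (Or.inr h) }
  le_sup_left _ _ := ⟨le_sup_left, Or.inl⟩
  le_sup_right _ _ := ⟨le_sup_right, Or.inr ∘ Or.inl⟩
  sup_le p q r hp hq := by
    refine ⟨sup_le hp.1 hq.1, ?_⟩
    rintro (h | h | h)
    · exact hp.2 h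
    · exact hq.2 h
    · exact r.upper_of_lt (h.trans_le (sup_le hp.1 hq.1))
  inf p q :=
    { val := p.val ⊓ q.val
      upper := p.upper ∧ q.upper
      le_of_upper := fun h => le_inf (p.le_of_upper h.1) (q.le_of_upper h.2)
      upper_of_lt := fun h =>
        ⟨p.upper_of_lt (h.trans_le inf_le_left), q.upper_of_lt (h.trans_le inf_le_right)⟩ }
  inf_le_left _ _ := ⟨inf_le_left, And.left⟩
  inf_le_right _ _ := ⟨inf_le_right, And.right⟩
  le_inf _ _ _ hp hq := ⟨le_inf hp.1 hq.1, fun h => ⟨hp.2 h, hq.2 h⟩⟩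

@[simp] theorem val_sup (p q : PointDoubling u) : (p ⊔ q).val = p.val ⊔ q.val := rfl

@[simp] theorem val_inf (p q : PointDoubling u) : (p ⊓ q).val = p.val ⊓ q.val := rfl

theorem upper_sup (p q : PointDoubling u) :
    (p ⊔ q).upper = (p.upper ∨ q.upper ∨ u < p.val ⊔ q.val) := rfl

theorem upper_inf (p q : PointDoubling u) : (p ⊓ q).upper = (p.upper ∧ q.upper) := rfl

/-- The lower copy of `u`. -/
def lower : PointDoubling u := ⟨u, False, False.elim, fun h => (lt_irrefl u h).elim⟩

/-- The upper copy of `u`. -/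
def higher : PointDoubling u := ⟨u, True, fun _ => le_rfl, fun _ => trivial⟩

/-- The section of the projection that sends `u` to its upper copy. -/
def lift (u x : L) : PointDoubling u := ⟨x, u ≤ x, id, le_of_lt⟩

theorem lower_ne_higher : (lower : PointDoubling u) ≠ higher := fun h =>
  (congrArg upper h).mpr trivial

theorem ext_of_val_ne {p q : PointDoubling u} (h : p.val = q.val) (hu : p.val ≠ u) : p = q := by
  have key : ∀ r : PointDoubling u, r.val ≠ u → (r.upper ↔ u ≤ r.val) := fun r hr =>
    ⟨r.le_of_upper, fun hle => r.upper_of_lt (lt_of_le_of_ne hle hr.symm)⟩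
  refine PointDoubling.ext h (propext ?_)
  rw [key p hu, key q (h ▸ hu), h]

theorem eq_lower_or_eq_higher {p : PointDoubling u} (h : p.val = u) : p = lower ∨ p = higher := by
  by_cases hp : p.upper
  · exact Or.inr (PointDoubling.ext h (eq_true hp))
  · exact Or.inl (PointDoubling.ext h (eq_false hp))

theorem sup_cases (r : PointDoubling u) :
    lower ⊔ r = higher ⊔ r ∨ (lower ⊔ r = lower ∧ higher ⊔ r = higher) := by
  by_cases h : u ⊔ r.val = u
  · rcases eq_lower_or_eq_higher (p := lower ⊔ r) h with h₁ | h₁ <;>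
      rcases eq_lower_or_eq_higher (p := higher ⊔ r) h with h₂ | h₂
    · exact Or.inl (h₁.trans h₂.symm)
    · exact Or.inr ⟨h₁, h₂⟩
    · exact ((congrArg upper h₂).mp (Or.inl trivial)).elim
    · exact Or.inl (h₁.trans h₂.symm)
  · exact Or.inl (ext_of_val_ne rfl h)

theorem inf_cases (r : PointDoubling u) :
    lower ⊓ r = higher ⊓ r ∨ (lower ⊓ r = lower ∧ higher ⊓ r = higher) := by
  by_cases h : u ⊓ r.val = u
  · rcases eq_lower_or_eq_higher (p := lower ⊓ r) h with h₁ | h₁ <;>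
      rcases eq_lower_or_eq_higher (p := higher ⊓ r) h with h₂ | h₂
    · exact Or.inl (h₁.trans h₂.symm)
    · exact Or.inr ⟨h₁, h₂⟩
    · exact ((congrArg upper h₁).mpr trivial).1.elim
    · exact Or.inl (h₁.trans h₂.symm)
  · exact Or.inl (ext_of_val_ne rfl h)

theorem joinSD (h : JoinSD L) : JoinSD (PointDoubling u) := by
  rintro w x y z rfl hz
  have hv := congrArg val hz
  have hb := congrArg upper hz
  have hs : x.val ⊔ y.val = x.val ⊔ (y.val ⊓ z.val) := h _ _ _ _ rfl hv
  refine PointDoubling.ext hs ?_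
  simp only [upper_sup, upper_inf, val_inf, val_sup] at hb hv ⊢
  rw [← hs]
  rw [← hv] at hb
  by_cases hx : x.upper <;> by_cases hlt : u < x.val ⊔ y.val <;> simp_all

theorem meetSD (h : MeetSD L) : MeetSD (PointDoubling u) := by
  rintro w x y z rfl hz
  have hv : x.val ⊓ y.val = x.val ⊓ z.val := congrArg val hz
  have hb : (x.upper ∧ y.upper) = (x.upper ∧ z.upper) := congrArg upper hz
  have hs : x.val ⊓ y.val = x.val ⊓ (y.val ⊔ z.val) := h _ _ _ _ rfl hv
  refine PointDoubling.ext hs (propext ?_)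
  rw [upper_inf, upper_inf, upper_sup]
  refine ⟨fun k => ⟨k.1, Or.inl k.2⟩, fun k => ⟨k.1, ?_⟩⟩
  have hyz : y.upper ↔ z.upper := by simpa [k.1] using hb
  rcases k with ⟨hx, hy | hz' | hlt⟩
  · exact hy
  · exact hyz.2 hz'
  · by_contra hy
    have hw : u ≤ x.val ⊓ y.val := hs ▸ le_inf (x.le_of_upper hx) hlt.le
    have hu : ∀ r : PointDoubling u, ¬ r.upper → u ≤ r.val → r.val = u := fun r hr hle =>
      (eq_of_le_of_not_lt hle (mt r.upper_of_lt hr)).symm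
    have ey := hu y hy (hw.trans inf_le_right)
    have ez := hu z (mt hyz.2 hy) ((hw.trans hv.le).trans inf_le_right)
    simp [ey, ez] at hlt

theorem infinite [Infinite L] : Infinite (PointDoubling u) :=
  Infinite.of_injective (lift u) fun _ _ h => congrArg val h

/-- The kernel of the projection. -/
def ker (u : L) : LatCon (PointDoubling u) where
  r p q := p.val = q.val
  refl' _ := rfl
  symm' := Eq.symm
  trans' := Eq.trans
  sup' h₁ h₂ := congrArg₂ (· ⊔ ·) h₁ h₂
  inf' h₁ h₂ := congrArg₂ (· ⊓ ·) h₁ h₂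

theorem ker_le {c : LatCon (PointDoubling u)} (hc : c.r lower higher) : ker u ≤ c := by
  intro p q (h : p.val = q.val)
  by_cases hp : p.val = u
  · rcases eq_lower_or_eq_higher hp with rfl | rfl <;>
      rcases eq_lower_or_eq_higher (h ▸ hp) with rfl | rfl
    · exact c.refl' _
    · exact hc
    · exact c.symm' hc
    · exact c.refl' _
  · rw [ext_of_val_ne h hp]
    exact c.refl' _

/-- The image in `L` of a congruence that contains the kernel of the projection. -/
def pushCon (c : LatCon (PointDoubling u)) (hc : ker u ≤ c) : LatCon L where
  r x y := c.r (lift u x) (lift u y)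
  refl' _ := c.refl' _
  symm' := c.symm'
  trans' := c.trans'
  sup' h₁ h₂ := c.trans' (hc _ (lift u _ ⊔ lift u _) rfl)
    (c.trans' (c.sup' h₁ h₂) (hc (lift u _ ⊔ lift u _) _ rfl))
  inf' h₁ h₂ := c.trans' (hc _ (lift u _ ⊓ lift u _) rfl)
    (c.trans' (c.inf' h₁ h₂) (hc (lift u _ ⊓ lift u _) _ rfl))

theorem eq_ker_or_eq_top (hL : IsSimpleLat L) {c : LatCon (PointDoubling u)}
    (hc : c.r lower higher) : c = ker u ∨ c = ⊤ := by
  have hk := ker_le hc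
  have push : ∀ {p q}, c.r p q ↔ (pushCon c hk).r p.val q.val := fun {p q} =>
    ⟨fun h => c.trans' (hk (lift u p.val) p rfl) (c.trans' h (hk q (lift u q.val) rfl)),
     fun h => c.trans' (hk p (lift u p.val) rfl) (c.trans' h (hk (lift u q.val) q rfl))⟩
  rcases hL.2 (pushCon c hk) with h | h
  · refine Or.inl (le_antisymm (fun p q hpq => ?_) hk)
    rw [push, h] at hpq
    exact hpq
  · refine Or.inr (top_le_iff.1 fun p q _ => ?_)
    rw [push, h]
    trivial

/-- The join of a congruence `c` with the kernel of the projection: the classes of the two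
copies of `u` are merged. -/
def merge (c : LatCon (PointDoubling u)) : LatCon (PointDoubling u) :=
  let near (p : PointDoubling u) : Prop := c.r p lower ∨ c.r p higher
  let rel (p q : PointDoubling u) : Prop := c.r p q ∨ (near p ∧ near q)
  have near_congr : ∀ {p q}, c.r p q → near q → near p := fun h =>
    Or.imp (c.trans' h) (c.trans' h)
  have symm : ∀ {p q}, rel p q → rel q p := fun h => h.imp c.symm' And.symm
  have trans : ∀ {p q r}, rel p q → rel q r → rel p r := by
    rintro p q r (h₁ | h₁) (h₂ | h₂)
    · exact Or.inl (c.trans' h₁ h₂)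
    · exact Or.inr ⟨near_congr h₁ h₂.1, h₂.2⟩
    · exact Or.inr ⟨h₁.1, near_congr (c.symm' h₂) h₁.2⟩
    · exact Or.inr ⟨h₁.1, h₂.2⟩
  have sup_right : ∀ {p q} r, rel p q → rel (p ⊔ r) (q ⊔ r) := by
    rintro p q r (h | ⟨hp, hq⟩)
    · exact Or.inl (c.sup' h (c.refl' r))
    · have hp := hp.imp (c.sup' · (c.refl' r)) (c.sup' · (c.refl' r))
      have hq := hq.imp (c.sup' · (c.refl' r)) (c.sup' · (c.refl' r))
      rcases sup_cases r with h | ⟨h₁, h₂⟩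
      · rw [h, or_self] at hp hq
        exact Or.inl (c.trans' hp (c.symm' hq))
      · rw [h₁, h₂] at hp hq
        exact Or.inr ⟨hp, hq⟩
  have inf_right : ∀ {p q} r, rel p q → rel (p ⊓ r) (q ⊓ r) := by
    rintro p q r (h | ⟨hp, hq⟩)
    · exact Or.inl (c.inf' h (c.refl' r))
    · have hp := hp.imp (c.inf' · (c.refl' r)) (c.inf' · (c.refl' r))
      have hq := hq.imp (c.inf' · (c.refl' r)) (c.inf' · (c.refl' r))
      rcases inf_cases r with h | ⟨h₁, h₂⟩
      · rw [h, or_self] at hp hq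
        exact Or.inl (c.trans' hp (c.symm' hq))
      · rw [h₁, h₂] at hp hq
        exact Or.inr ⟨hp, hq⟩
  { r := rel
    refl' := fun p => Or.inl (c.refl' p)
    symm' := symm
    trans' := trans
    sup' := fun {p q p' q'} h h' =>
      trans (sup_right p' h) (by simpa only [sup_comm q] using sup_right q h')
    inf' := fun {p q p' q'} h h' =>
      trans (inf_right p' h) (by simpa only [inf_comm q] using inf_right q h') }

theorem eq_bot_of_not_rel (hL : IsSimpleLat L) {y : L} (h₁ : ¬ u ≤ y) (h₂ : ¬ y ≤ u)
    {c : LatCon (PointDoubling u)} (hc : ¬ c.r lower higher) : c = ⊥ := by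
  have hm : (merge c).r lower higher := Or.inr ⟨Or.inl (c.refl' _), Or.inr (c.refl' _)⟩
  rcases eq_ker_or_eq_top hL hm with h | h
  · refine le_bot_iff.1 fun p q hpq => ?_
    have hv : p.val = q.val := by
      have : (merge c).r p q := Or.inl hpq
      rwa [h] at this
    by_cases hp : p.val = u
    · rcases eq_lower_or_eq_higher hp with rfl | rfl <;>
        rcases eq_lower_or_eq_higher (hv ▸ hp) with rfl | rfl
      · exact rfl
      · exact (hc hpq).elim
      · exact (hc (c.symm' hpq)).elim
      · exact rfl
    · exact ext_of_val_ne hv hp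
  · exfalso
    have hr : (merge c).r (lift u y) lower := by rw [h]; trivial
    have hy : c.r (lift u y) lower ∨ c.r (lift u y) higher := hr.elim Or.inl And.left
    rcases hy with hy | hy
    · have e : lower ⊔ lift u y = higher ⊔ lift u y :=
        ext_of_val_ne rfl fun e => h₂ (sup_eq_left.1 e)
      have k₁ := c.sup' (c.refl' lower) hy
      have k₂ := c.sup' (c.refl' higher) hy
      have e' : (higher ⊔ lower : PointDoubling u) = higher :=
        sup_eq_left.2 ⟨le_rfl, fun _ => trivial⟩
      rw [sup_idem, e] at k₁
      rw [e'] at k₂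
      exact hc (c.trans' (c.symm' k₁) k₂)
    · have e : lower ⊓ lift u y = higher ⊓ lift u y :=
        ext_of_val_ne rfl fun e => h₁ (inf_eq_left.1 e)
      have k₁ := c.inf' (c.refl' lower) hy
      have k₂ := c.inf' (c.refl' higher) hy
      have e' : (lower ⊓ higher : PointDoubling u) = lower :=
        inf_eq_left.2 ⟨le_rfl, fun _ => trivial⟩
      rw [e', e] at k₁
      rw [inf_idem] at k₂
      exact hc (c.trans' (c.symm' k₁) k₂)

/-- Doubling a point that is incomparable to some other point turns a simple lattice into one
whose congruence lattice is a three-element chain. -/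
theorem nonempty_latCon_orderIso (hL : IsSimpleLat L) {y : L} (h₁ : ¬ u ≤ y) (h₂ : ¬ y ≤ u) :
    Nonempty (LatCon (PointDoubling u) ≃o Fin 3) := by
  have hbot : (⊥ : LatCon (PointDoubling u)) < ker u := by
    refine bot_lt_iff_ne_bot.2 fun h => lower_ne_higher (u := u) ?_
    have : (ker u).r lower higher := rfl
    rwa [h] at this
  have htop : ker u < ⊤ := by
    refine lt_top_iff_ne_top.2 fun h => h₁ (le_of_eq ?_)
    have : (ker u).r (lift u u) (lift u y) := by rw [h]; trivial
    exact this
  let f : Fin 3 → LatCon (PointDoubling u) := ![⊥, ker u, ⊤]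
  have hf : StrictMono f := by
    refine Fin.strictMono_iff_lt_succ.2 fun i => ?_
    fin_cases i
    · exact hbot
    · exact htop
  have hs : Function.Surjective f := by
    intro c
    by_cases hc : c.r lower higher
    · rcases eq_ker_or_eq_top hL hc with h | h
      · exact ⟨1, h.symm⟩
      · exact ⟨2, h.symm⟩
    · exact ⟨0, (eq_bot_of_not_rel hL h₁ h₂ hc).symm⟩
  exact ⟨(hf.orderIsoOfSurjective f hs).symm⟩

end PointDoubling

/-- In a lattice that is a chain, the congruence that collapses all elements below `b`. -/
def LatCon.collapseBelow {L : Type*} [Lattice L] (hL : ∀ x y : L, x ≤ y ∨ y ≤ x) (b : L) :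
    LatCon L :=
  have dist : ∀ x y : L, x ⊓ y ⊔ b = (x ⊔ b) ⊓ (y ⊔ b) := fun x y => by
    rcases hL x y with h | h
    · rw [inf_eq_left.2 h, inf_eq_left.2 (sup_le_sup_right h b)]
    · rw [inf_eq_right.2 h, inf_eq_right.2 (sup_le_sup_right h b)]
  { r := fun x y => x ⊔ b = y ⊔ b
    refl' := fun _ => rfl
    symm' := Eq.symm
    trans' := Eq.trans
    sup' := fun h h' => by rw [sup_sup_distrib_right, h, h', ← sup_sup_distrib_right]
    inf' := fun h h' => by rw [dist, h, h', ← dist] }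

theorem IsSimpleLat.exists_incomparable {L : Type*} [Lattice L] [Infinite L]
    (hL : IsSimpleLat L) : ∃ u y : L, ¬ u ≤ y ∧ ¬ y ≤ u := by
  classical
  by_contra! hcomp
  have htot : ∀ x y : L, x ≤ y ∨ y ≤ x := fun x y => or_iff_not_imp_left.2 (hcomp x y)
  have no_chain : ∀ a b c : L, a ≤ b → b ≤ c → a ≠ b → b ≠ c → False := by
    intro a b c hab hbc nab nbc
    rcases hL.2 (LatCon.collapseBelow htot b) with h | h
    · have : (LatCon.collapseBelow htot b).r a b := (sup_eq_right.2 hab).trans (sup_idem b).symm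
      rw [h] at this
      exact nab this
    · have : (LatCon.collapseBelow htot b).r b c := by rw [h]; trivial
      exact nbc (((sup_idem b).symm.trans this).trans (sup_eq_left.2 hbc))
  obtain ⟨s, hs⟩ := Infinite.exists_subset_card_eq L 3
  obtain ⟨x, y, z, hxy, hxz, hyz, -⟩ := Finset.card_eq_three.1 hs
  rcases htot x y with h₁ | h₁ <;> rcases htot y z with h₂ | h₂ <;> rcases htot x z with h₃ | h₃ <;>
    grind

/-! ### STATEMENT 8 -/

/-- Assuming the existence of an FN lattice, there exists an infinite
semidistributive lattice whose congruence lattice is a three-element chain. -/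
theorem statement8 (hFN : ∃ (F : Type) (instF : Lattice F), IsFNP F instF) :
    ∃ (K : Type) (instK : Lattice K),
      Infinite K ∧ SDP K instK ∧ ConIso K instK (Fin 3) := by
  obtain ⟨F, instF, hinf, hsimple, hjoin, hmeet⟩ := hFN
  obtain ⟨u, y, h₁, h₂⟩ := hsimple.exists_incomparable
  exact ⟨PointDoubling u, inferInstance, PointDoubling.infinite,
    ⟨PointDoubling.joinSD hjoin, PointDoubling.meetSD hmeet⟩,
    PointDoubling.nonempty_latCon_orderIso hsimple h₁ h₂⟩
end
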